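/- arXiv:0904.2374 — 2 statements merged into one kernel-verified Lean document; each statement's English description precedes it below -/
import Mathlib

section
/- The singular locus of a reduced irreducible ruled quartic surface S ⊂ ℙ(V) (which is not a cone) cannot be an irreducible plane conic: there is no ruled quartic surface whose singular locus is a conic of multiplicity 2 and nothing else. -/
namespace RQS

open MvPolynomial


open MvPolynomial

variable (K : Type) [Field K]

/-- Projective n-space modelled as the projectivization of `Fin n → K`
(so `PP K (n+1)` is ℙⁿ). -/
abbrev PP (n : ℕ) : Type := Projectivization K (Fin n → K)

variable {K}

/-- Vanishing of a (homogeneous) polynomial at a projective point. -/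
def vanishes {n : ℕ} (p : MvPolynomial (Fin n) K) (x : PP K n) : Prop :=
  ∀ (v : Fin n → K) (h : v ≠ 0), Projectivization.mk K v h = x → eval v p = 0

/-- Projective zero locus of a set of polynomials. -/
def zeroLocus {n : ℕ} (S : Set (MvPolynomial (Fin n) K)) : Set (PP K n) :=
  {x | ∀ p ∈ S, vanishes p x}

/-- Zariski closed subsets of projective space. -/
def ZClosed {n : ℕ} (X : Set (PP K n)) : Prop :=
  ∃ S : Set (MvPolynomial (Fin n) K), (∀ p ∈ S, ∃ d, p.IsHomogeneous d) ∧ X = zeroLocus S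

/-- Irreducibility with respect to the Zariski topology. -/
def ZIrred {n : ℕ} (X : Set (PP K n)) : Prop :=
  X.Nonempty ∧ ∀ A B : Set (PP K n), ZClosed A → ZClosed B → X ⊆ A ∪ B → X ⊆ A ∨ X ⊆ B

/-- `X` contains a chain of closed irreducible subsets of length `d+1`. -/
def dimGE {n : ℕ} (X : Set (PP K n)) (d : ℕ) : Prop :=
  ∃ f : Fin (d + 1) → Set (PP K n),
    (∀ i, ZClosed (f i) ∧ ZIrred (f i) ∧ f i ⊆ X) ∧ StrictMono f

/-- `X` has (Krull) dimension exactly `d`. -/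
def HasDim {n : ℕ} (X : Set (PP K n)) (d : ℕ) : Prop := dimGE X d ∧ ¬ dimGE X (d + 1)

/-- The hyperplane with coefficient vector `φ`. -/
def hyp {n : ℕ} (φ : Fin n → K) : Set (PP K n) :=
  {x | ∀ (v : Fin n → K) (h : v ≠ 0), Projectivization.mk K v h = x → ∑ i, φ i * v i = 0}

/-- Degree of a (reduced) curve: every hyperplane not containing it meets it in at most `d`
points, and some hyperplane meets it in exactly `d` points. -/
def HasCurveDeg {n : ℕ} (X : Set (PP K n)) (d : ℕ) : Prop :=
  (∀ φ : Fin n → K, φ ≠ 0 → ¬ X ⊆ hyp φ →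
    (X ∩ hyp φ).Finite ∧ (X ∩ hyp φ).ncard ≤ d) ∧
  (∃ φ : Fin n → K, φ ≠ 0 ∧ ¬ X ⊆ hyp φ ∧ (X ∩ hyp φ).ncard = d)

/-- An irreducible projective curve of degree `d`. -/
def IsCurveOfDeg {n : ℕ} (X : Set (PP K n)) (d : ℕ) : Prop :=
  ZClosed X ∧ ZIrred X ∧ HasDim X 1 ∧ HasCurveDeg X d

/-- A property holds at a general point of `S`. -/
def GenericPts {n : ℕ} (S : Set (PP K n)) (Q : PP K n → Prop) : Prop :=
  ∃ T : Set (PP K n), ZClosed T ∧ ¬ S ⊆ T ∧ ∀ p ∈ S, p ∉ T → Q p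

/-! ### Plücker coordinates: `p₁₂,p₁₃,p₁₄,p₂₃,p₂₄,p₃₄` indexed by `0,…,5` -/

/-- Plücker coordinates of the line through `u` and `v`, i.e. the bivector `u ∧ v`. -/
def plucker (u v : Fin 4 → K) : Fin 6 → K :=
  ![u 0 * v 1 - u 1 * v 0, u 0 * v 2 - u 2 * v 0, u 0 * v 3 - u 3 * v 0,
    u 1 * v 2 - u 2 * v 1, u 1 * v 3 - u 3 * v 1, u 2 * v 3 - u 3 * v 2]

/-- The Plücker quadric `p₁₂p₃₄ - p₁₃p₂₄ + p₁₄p₂₃`, i.e. `½ w ∧ w`. -/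
def plQuad (w : Fin 6 → K) : K := w 0 * w 5 - w 1 * w 4 + w 2 * w 3

/-- The wedge pairing `w ∧ z ∈ Λ⁴V ≅ K` of two bivectors. -/
def plPair (w z : Fin 6 → K) : K :=
  w 0 * z 5 + w 5 * z 0 - w 1 * z 4 - w 4 * z 1 + w 2 * z 3 + w 3 * z 2

/-- The wedge `w ∧ v ∈ Λ³V ≅ V*` of a bivector `w` with a vector `v`;
`w ∧ v = 0` expresses that the point `v̄` lies on the line `w̄`. -/
def wedgePt (w : Fin 6 → K) (v : Fin 4 → K) : Fin 4 → K :=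
  ![w 0 * v 2 - w 1 * v 1 + w 3 * v 0,
    w 0 * v 3 - w 2 * v 1 + w 4 * v 0,
    w 1 * v 3 - w 2 * v 2 + w 5 * v 0,
    w 3 * v 3 - w 4 * v 2 + w 5 * v 1]

/-- The set of points of ℙ³ on the line with Plücker vector `w`. -/
def lineOfRep (w : Fin 6 → K) : Set (PP K 4) :=
  {p | ∀ (v : Fin 4 → K) (h : v ≠ 0), Projectivization.mk K v h = p → wedgePt w v = 0}

/-- `w` represents a line of ℙ³: it is nonzero and decomposable. -/
def IsLineRep (w : Fin 6 → K) : Prop := w ≠ 0 ∧ plQuad w = 0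

variable (K) in
/-- The Grassmannian `Gr(2,4) ⊂ ℙ⁵` of lines in ℙ³. -/
def grass : Set (PP K 6) :=
  {x | ∃ (w : Fin 6 → K) (h : w ≠ 0), Projectivization.mk K w h = x ∧ plQuad w = 0}

/-- The line in ℙ³ corresponding to a point `x` of the Grassmannian. -/
def lineOf (x : PP K 6) : Set (PP K 4) :=
  {p | ∀ (w : Fin 6 → K) (h : w ≠ 0), Projectivization.mk K w h = x → p ∈ lineOfRep w}

/-- The set of (Grassmann points of) lines contained in a surface `S ⊂ ℙ³`. -/
def linesOf (S : Set (PP K 4)) : Set (PP K 6) :=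
  {x | x ∈ grass K ∧ lineOf x ⊆ S}

/-- A ruled surface: an irreducible closed surface which is a union of lines. -/
def IsRuled (S : Set (PP K 4)) : Prop :=
  ZClosed S ∧ ZIrred S ∧ HasDim S 2 ∧ ∀ p ∈ S, ∃ x ∈ linesOf S, p ∈ lineOf x

/-- Degree of a surface in ℙ³ via intersections with lines. -/
def HasSurfDeg (S : Set (PP K 4)) (d : ℕ) : Prop :=
  (∀ w : Fin 6 → K, IsLineRep w → ¬ lineOfRep w ⊆ S →
    (S ∩ lineOfRep w).Finite ∧ (S ∩ lineOfRep w).ncard ≤ d) ∧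
  (∃ w : Fin 6 → K, IsLineRep w ∧ ¬ lineOfRep w ⊆ S ∧ (S ∩ lineOfRep w).ncard = d)

/-- A cone: all lines of `S` pass through a common point. -/
def IsCone (S : Set (PP K 4)) : Prop :=
  ∃ p : PP K 4, ∀ x ∈ linesOf S, p ∈ lineOf x

/-- `σ₂(p₀)`: the 2-plane in the Grassmannian of all lines through `p₀`. -/
def sigma2 (p₀ : PP K 4) : Set (PP K 6) := {x | x ∈ grass K ∧ p₀ ∈ lineOf x}

/-- The projective tangent space `T_{Gr,x₀}` of the Plücker quadric at `x₀`,
namely the hyperplane `{z̄ : w₀ ∧ z = 0}`. -/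
def tangentGr (x₀ : PP K 6) : Set (PP K 6) :=
  {x | ∀ (w : Fin 6 → K) (h : w ≠ 0), Projectivization.mk K w h = x →
    ∀ (w₀ : Fin 6 → K) (h₀ : w₀ ≠ 0), Projectivization.mk K w₀ h₀ = x₀ → plPair w₀ w = 0}

/-- The linear span of (the representatives of) a subset of projective space. -/
def spanOfSet {n : ℕ} (X : Set (PP K n)) : Submodule K (Fin n → K) :=
  Submodule.span K {v | ∃ h : v ≠ 0, Projectivization.mk K v h ∈ X}

/-- The projective subspace associated to a linear subspace. -/
def projSub {n : ℕ} (U : Submodule K (Fin n → K)) : Set (PP K n) :=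
  {x | ∀ (v : Fin n → K) (h : v ≠ 0), Projectivization.mk K v h = x → v ∈ U}

/-- `P(C)`: the smallest projective subspace containing `C`. -/
def projSpanOf {n : ℕ} (X : Set (PP K n)) : Set (PP K n) := projSub (spanOfSet X)

/-! ### Smoothness via Jacobian criteria -/

/-- The homogeneous polynomials vanishing on `X`. -/
def homIdeal {n : ℕ} (X : Set (PP K n)) : Set (MvPolynomial (Fin n) K) :=
  {p | (∃ d, p.IsHomogeneous d) ∧ ∀ x ∈ X, vanishes p x}

/-- The span of the gradients at `v` of all homogeneous polynomials vanishing on `X`. -/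
def gradSpan {n : ℕ} (X : Set (PP K n)) (v : Fin n → K) : Submodule K (Fin n → K) :=
  Submodule.span K
    {g | ∃ p ∈ homIdeal X, g = fun i => eval v (pderiv i p)}

/-- Smooth point of a projective *curve* `X ⊂ ℙ(Kⁿ)` (Jacobian criterion:
the affine cone over `X` has a 2-dimensional tangent space there). -/
def CurveSmoothPt {n : ℕ} (X : Set (PP K n)) (x : PP K n) : Prop :=
  ∀ (v : Fin n → K) (h : v ≠ 0), Projectivization.mk K v h = x →
    Module.finrank K (gradSpan X v) = n - 2

/-- Smooth point of a *surface* `S ⊂ ℙ³` (Jacobian criterion). -/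
def SurfSmoothPt (S : Set (PP K 4)) (x : PP K 4) : Prop :=
  ∀ (v : Fin 4 → K) (h : v ≠ 0), Projectivization.mk K v h = x →
    Module.finrank K (gradSpan S v) = 1

/-- The singular locus of a surface `S ⊂ ℙ³`. -/
def singLocus (S : Set (PP K 4)) : Set (PP K 4) := {x ∈ S | ¬ SurfSmoothPt S x}


/-! STATEMENT 13: the singular locus of a ruled quartic surface cannot be a conic. -/

/-- An (irreducible, plane) conic in ℙ³: an irreducible closed plane curve of degree 2. -/
def IsConic {K : Type} [Field K] (D : Set (PP K 4)) : Prop :=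
  ZClosed D ∧ ZIrred D ∧ HasDim D 1 ∧ HasCurveDeg D 2 ∧
    ∃ φ : Fin 4 → K, φ ≠ 0 ∧ D ⊆ hyp φ

section Algebra

/-- A polynomial ring in `n` variables over a field has no chain of `n + 2` primes. -/
lemma not_strictMono_primeSpectrum {n : ℕ}
    (f : Fin (n + 2) → PrimeSpectrum (MvPolynomial (Fin n) K)) : ¬ StrictMono f := by
  intro hf
  have h := Order.LTSeries.length_le_krullDim (LTSeries.mk (n + 1) f hf)
  have h2 : Order.krullDim (PrimeSpectrum (MvPolynomial (Fin n) K)) = n := by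
    have := MvPolynomial.ringKrullDim_of_isNoetherianRing (R := K) (ι := Fin n)
    rw [ringKrullDim_eq_zero_of_field, zero_add] at this
    rw [Nat.card_fin] at this
    exact this
  rw [h2] at h
  have h3 : ((n + 1 : ℕ) : WithBot ℕ∞) ≤ (n : WithBot ℕ∞) := h
  have : n + 1 ≤ n := by exact_mod_cast h3
  omega

/-- Scaling a point multiplies the value of a homogeneous polynomial by a power. -/
lemma eval_smul_of_isHomogeneous {σ : Type*} {p : MvPolynomial σ K} {d : ℕ}
    (hp : p.IsHomogeneous d) (t : K) (v : σ → K) : eval (t • v) p = t ^ d * eval v p := by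
  rw [eval_eq, eval_eq, Finset.mul_sum]
  refine Finset.sum_congr rfl fun m hm => ?_
  have hd := hp.degree_eq_sum_deg_support hm
  simp only [Pi.smul_apply, smul_eq_mul, mul_pow, Finset.prod_mul_distrib,
    Finset.prod_pow_eq_pow_sum]
  rw [hd]
  ring

attribute [local instance] MvPolynomial.gradedAlgebra

lemma decompose_eq_homogeneousComponent {σ : Type*} (p : MvPolynomial σ K) (i : ℕ) :
    (DirectSum.decompose (homogeneousSubmodule σ K) p i : MvPolynomial σ K) =
      homogeneousComponent i p :=
  decomposition.decompose'_apply p i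

/-- The vanishing ideal of a cone is homogeneous. -/
lemma isHomogeneous_vanishingIdeal [Infinite K] {σ : Type*} {V : Set (σ → K)}
    (hV : ∀ v ∈ V, ∀ t : K, t ≠ 0 → t • v ∈ V) :
    (vanishingIdeal K V).IsHomogeneous (homogeneousSubmodule σ K) := by
  intro i p hp
  rw [decompose_eq_homogeneousComponent]
  intro v hv
  rw [aeval_eq_eval]
  let g : Polynomial K := ∑ j ∈ Finset.range (p.totalDegree + 1),
    Polynomial.monomial j (eval v (homogeneousComponent j p))
  have hg : g * Polynomial.X = 0 := by
    apply Polynomial.funext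
    intro t
    by_cases ht : t = 0
    · simp [ht]
    have h1 : eval (t • v) p = 0 := by
      have := hp _ (hV v hv t ht)
      rwa [aeval_eq_eval] at this
    rw [← sum_homogeneousComponent p, map_sum] at h1
    simp only [Polynomial.eval_mul, Polynomial.eval_X, Polynomial.eval_zero, mul_eq_zero]
    left
    rw [← h1, Polynomial.eval_finsetSum]
    refine Finset.sum_congr rfl fun j _ => ?_
    rw [eval_smul_of_isHomogeneous (homogeneousComponent_isHomogeneous j p)]
    simp [mul_comm]
  have hg0 : g = 0 := by simpa using hg
  by_cases hi : i < p.totalDegree + 1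
  · have := congrArg (fun q : Polynomial K => q.coeff i) hg0
    simpa [g, Polynomial.finsetSum_coeff, Polynomial.coeff_monomial, hi] using this
  · rw [homogeneousComponent_eq_zero _ _ (by omega)]
    simp

/-- A cone which is irreducible with respect to homogeneous polynomials has a prime vanishing
ideal. -/
lemma isPrime_vanishingIdeal [Infinite K] {σ : Type*} {V : Set (σ → K)} (hne : V.Nonempty)
    (hV : ∀ v ∈ V, ∀ t : K, t ≠ 0 → t • v ∈ V)
    (hirr : ∀ (a b : MvPolynomial σ K) (i j : ℕ), a.IsHomogeneous i → b.IsHomogeneous j →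
      (∀ v ∈ V, eval v a * eval v b = 0) → (∀ v ∈ V, eval v a = 0) ∨ (∀ v ∈ V, eval v b = 0)) :
    (vanishingIdeal K V).IsPrime := by
  refine (isHomogeneous_vanishingIdeal hV).isPrime_of_homogeneous_mem_or_mem ?_ ?_
  · intro h
    obtain ⟨v, hv⟩ := hne
    have : (1 : MvPolynomial σ K) ∈ vanishingIdeal K V := h ▸ Submodule.mem_top
    simpa using this v hv
  · rintro a b ⟨i, hi⟩ ⟨j, hj⟩ hab
    exact hirr a b i j hi hj (fun v hv => by simpa [aeval_eq_eval] using hab v hv)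

/-- A nonzero homogeneous prime ideal of a polynomial ring contains an irreducible homogeneous
polynomial. -/
lemma exists_irreducible_isHomogeneous_mem {σ : Type*} {J : Ideal (MvPolynomial σ K)}
    [hJ : J.IsPrime] (hhom : J.IsHomogeneous (homogeneousSubmodule σ K)) (hbot : J ≠ ⊥) :
    ∃ (F : MvPolynomial σ K) (d : ℕ), F.IsHomogeneous d ∧ Irreducible F ∧ F ∈ J := by
  classical
  have hcomp : ∀ p ∈ J, p ≠ 0 → ∃ i ≤ p.totalDegree, ∃ q ∈ J, q ≠ 0 ∧ q.IsHomogeneous i := by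
    intro p hp hp0
    by_contra! hcon
    apply hp0
    rw [← sum_homogeneousComponent p]
    refine Finset.sum_eq_zero fun i hi => ?_
    by_contra hne
    exact hcon i (by simpa [Nat.lt_succ_iff] using hi) _ (homogeneousComponent_mem_of_mem hhom hp i)
      hne (homogeneousComponent_isHomogeneous i p)
  have hex : ∃ d : ℕ, ∃ q ∈ J, q ≠ 0 ∧ q.IsHomogeneous d := by
    obtain ⟨p, hp, hp0⟩ := Submodule.exists_mem_ne_zero_of_ne_bot hbot
    obtain ⟨i, -, hi⟩ := hcomp p hp hp0
    exact ⟨i, hi⟩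
  obtain ⟨F, hFJ, hF0, hFd⟩ := Nat.find_spec hex
  have hmin : ∀ p ∈ J, p ≠ 0 → Nat.find hex ≤ p.totalDegree := by
    intro p hp hp0
    obtain ⟨i, hi, hq⟩ := hcomp p hp hp0
    exact (Nat.find_min' hex hq).trans hi
  have hunit : ∀ a b : MvPolynomial σ K, F = a * b → a ∈ J → IsUnit b := by
    intro a b hab ha
    have ha0 : a ≠ 0 := by rintro rfl; simp [hab] at hF0
    have hb0 : b ≠ 0 := by rintro rfl; simp [hab] at hF0
    have h1 := hFd.totalDegree hF0
    rw [hab, totalDegree_mul_of_isDomain ha0 hb0] at h1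
    have h2 := hmin a ha ha0
    have h3 : b.totalDegree = 0 := by omega
    rw [totalDegree_eq_zero_iff_eq_C] at h3
    rw [h3] at hb0 ⊢
    have : coeff 0 b ≠ 0 := by rintro h; simp [h] at hb0
    exact (isUnit_iff_ne_zero.2 this).map C
  refine ⟨F, _, hFd, ⟨fun hu => hJ.ne_top (Ideal.eq_top_of_isUnit_mem _ hFJ hu), ?_⟩, hFJ⟩
  intro a b hab
  rcases hJ.mem_or_mem (hab ▸ hFJ : a * b ∈ J) with h | h
  · exact Or.inr (hunit a b hab h)
  · exact Or.inl (hunit b a (by rw [hab, mul_comm]) h)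

/-- The cofactor of a homogeneous divisor of a homogeneous polynomial is homogeneous. -/
lemma isHomogeneous_of_mul_left {σ : Type*} {p g : MvPolynomial σ K} {e d : ℕ} (hp0 : p ≠ 0)
    (hp : p.IsHomogeneous e) (hpg : (p * g).IsHomogeneous (e + d)) : g.IsHomogeneous d := by
  have h : ∀ i, i ≠ d → homogeneousComponent i g = 0 := by
    intro i hi
    have h1 := DirectSum.coe_decompose_mul_add_of_left_mem (homogeneousSubmodule σ K)
      (a := p) (b := g) (i := e) (j := i) hp
    rw [decompose_eq_homogeneousComponent, decompose_eq_homogeneousComponent,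
      homogeneousComponent_of_mem hpg, if_neg (by omega)] at h1
    simpa [hp0] using h1.symm
  have h2 : g = homogeneousComponent d g := by
    conv_lhs => rw [← sum_homogeneousComponent g]
    by_cases hd : d < g.totalDegree + 1
    · exact Finset.sum_eq_single_of_mem d (by simpa using hd) (fun i _ hi => h i hi)
    · rw [homogeneousComponent_eq_zero _ _ (by omega)]
      exact Finset.sum_eq_zero fun i hi => h i (by rintro rfl; simp at hi; omega)
  rw [h2]
  exact homogeneousComponent_isHomogeneous d g

/-- A polynomial vanishing on the zero set of an irreducible polynomial is divisible by it. -/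
lemma dvd_of_forall_eval_eq_zero [IsAlgClosed K] {σ : Type*} [Finite σ] {F G : MvPolynomial σ K}
    (hF : Irreducible F) (h : ∀ v, eval v F = 0 → eval v G = 0) : F ∣ G := by
  have hP : (Ideal.span {F}).IsPrime :=
    (Ideal.span_singleton_prime hF.ne_zero).2 hF.prime
  rw [← Ideal.mem_span_singleton, ← IsPrime.vanishingIdeal_zeroLocus (K := K) (Ideal.span {F})]
  intro v hv
  rw [aeval_eq_eval]
  apply h
  have := hv F (Ideal.mem_span_singleton_self F)
  rwa [aeval_eq_eval] at this

end Algebra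

section Points

/-- The derivative of a polynomial in a constant direction. -/
noncomputable def dirDeriv {σ : Type*} (u : σ → K) :
    Derivation K (MvPolynomial σ K) (MvPolynomial σ K) :=
  mkDerivation K (fun i => C (u i))

@[simp]
lemma dirDeriv_X {σ : Type*} (u : σ → K) (i : σ) : dirDeriv u (X i) = C (u i) :=
  mkDerivation_X _ _ _

@[simp]
lemma dirDeriv_C {σ : Type*} (u : σ → K) (a : K) : dirDeriv u (C a) = 0 :=
  derivation_C _ _

lemma eval_dirDeriv_mul {σ : Type*} (u x : σ → K) (f g : MvPolynomial σ K) :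
    eval x (dirDeriv u (f * g)) =
      eval x f * eval x (dirDeriv u g) + eval x g * eval x (dirDeriv u f) := by
  simp

lemma vanishingIdeal_singleton_injective {σ : Type*} {x y : σ → K}
    (h : vanishingIdeal K {x} = vanishingIdeal K {y}) : x = y := by
  funext i
  have : X i - C (x i) ∈ vanishingIdeal K {y} := by
    rw [← h]
    simp
  have h2 := this y rfl
  simp [sub_eq_zero] at h2
  exact h2.symm

lemma isMaximal_vanishingIdeal_singleton {σ : Type*} (x : σ → K) :
    (vanishingIdeal K {x}).IsMaximal := inferInstance

/-- At a zero without tangent vectors, every element of the maximal ideal lies in its square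
modulo the equations. -/
lemma vanishingIdeal_singleton_le_sup {σ : Type*} {fs : Set (MvPolynomial σ K)} {x : σ → K}
    (hx : ∀ f ∈ fs, eval x f = 0)
    (ht : ∀ y : σ → K, (∀ f ∈ fs, eval x (dirDeriv y f) = 0) → y = 0) :
    vanishingIdeal K {x} ≤ vanishingIdeal K {x} * vanishingIdeal K {x} ⊔ Ideal.span fs := by
  set m := vanishingIdeal K {x} with hm
  have hmem : ∀ g : MvPolynomial σ K, g ∈ m ↔ eval x g = 0 := by
    intro g; simp [hm, aeval_eq_eval]
  intro a ha
  by_contra hcon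
  have hJm : m * m ⊔ Ideal.span fs ≤ m :=
    sup_le Ideal.mul_le_left (Ideal.span_le.2 fun f hf => (hmem f).2 (hx f hf))
  let T : Submodule K (MvPolynomial σ K) :=
    (m * m ⊔ Ideal.span fs).restrictScalars K ⊔ Submodule.span K {1}
  have haT : a ∉ T := by
    intro haT
    obtain ⟨j, hj, c, hc, hjc⟩ := Submodule.mem_sup.1 haT
    obtain ⟨c, rfl⟩ := Submodule.mem_span_singleton.1 hc
    have h1 : eval x j = 0 := (hmem j).1 (hJm hj)
    have h2 : eval x a = 0 := (hmem a).1 ha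
    rw [← hjc] at h2
    have h3 : c = 0 := by simpa [h1, smul_eval] using h2
    apply hcon
    rw [← hjc, h3, zero_smul, add_zero]
    exact hj
  obtain ⟨l, hla, hlT⟩ := Submodule.exists_le_ker_of_notMem haT
  have hl1 : l 1 = 0 := hlT (Submodule.mem_sup_right (Submodule.mem_span_singleton_self 1))
  have hlJ : ∀ g ∈ m * m ⊔ Ideal.span fs, l g = 0 := fun g hg => hlT (Submodule.mem_sup_left hg)
  have hlC : ∀ c : K, l (C c) = 0 := by
    intro c
    rw [← mul_one (C c), ← smul_eq_C_mul, map_smul, hl1, smul_zero]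
  have hleib : ∀ g h, l (g * h) = eval x g * l h + eval x h * l g := by
    intro g h
    have h1 : (g - C (eval x g)) * (h - C (eval x h)) ∈ m * m ⊔ Ideal.span fs :=
      Ideal.mem_sup_left (Ideal.mul_mem_mul ((hmem _).2 (by simp)) ((hmem _).2 (by simp)))
    have h2 := hlJ _ h1
    have h3 : (g - C (eval x g)) * (h - C (eval x h)) =
        g * h - eval x g • h - eval x h • g + C (eval x g * eval x h) := by
      simp only [smul_eq_C_mul, map_mul]; ring
    rw [h3, map_add, map_sub, map_sub, map_smul, map_smul, hlC] at h2
    simp only [smul_eq_mul] at h2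
    linear_combination h2
  have hd : ∀ g, l g = eval x (dirDeriv (fun i => l (X i)) g) := by
    intro g
    induction g using MvPolynomial.induction_on with
    | C c => simp [hlC]
    | add p q hp hq => simp [hp, hq]
    | mul_X p i hp => rw [hleib, eval_dirDeriv_mul, hp]; simp
  have hy : (fun i => l (X i)) = 0 :=
    ht _ fun f hf => by rw [← hd]; exact hlJ f (Ideal.mem_sup_right (Ideal.subset_span hf))
  apply hla
  rw [hd, hy]
  clear * -
  induction a using MvPolynomial.induction_on with
  | C c => simp
  | add p q hp hq => simp [hp, hq]
  | mul_X p i hp => rw [eval_dirDeriv_mul, hp]; simp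

/-- A maximal ideal which is contained in the sum of its square and an ideal `I` is minimal over
`I`. -/
lemma le_of_le_mul_self_sup {R : Type*} [CommRing R] [IsNoetherianRing R] {m I P : Ideal R}
    (hmax : m ≠ ⊤) (hP : P.IsPrime) (hle : m ≤ m * m ⊔ I) (hIP : I ≤ P) (hPm : P ≤ m) :
    m ≤ P := by
  obtain ⟨r, hr, hrm⟩ := Submodule.exists_sub_one_mem_and_smul_le_of_fg_of_le_sup
    (I := m) (N := P) (N' := m) (P := m) (IsNoetherian.noetherian m) le_rfl
    (hle.trans (sup_comm (m * m) I ▸ sup_le_sup_right hIP _))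
  have hrm' : r ∉ m := fun h => hmax ((Ideal.eq_top_iff_one m).2 (by
    simpa using Ideal.sub_mem _ h hr))
  intro a ha
  have h1 : r * a ∈ P := hrm (Submodule.smul_mem_pointwise_smul a r m ha)
  exact (hP.mem_or_mem h1).resolve_left fun h => hrm' (hPm h)

/-- A system of polynomial equations none of whose solutions admits a nonzero tangent vector has
only finitely many solutions. -/
lemma finite_zeros_of_tangent_eq_zero {σ : Type*} [Finite σ] (fs : Set (MvPolynomial σ K))
    (ht : ∀ x : σ → K, (∀ f ∈ fs, eval x f = 0) →
      ∀ y : σ → K, (∀ f ∈ fs, eval x (dirDeriv y f) = 0) → y = 0) :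
    {x : σ → K | ∀ f ∈ fs, eval x f = 0}.Finite := by
  refine Set.Finite.of_injOn (f := fun x : σ → K => vanishingIdeal K {x})
    (t := (Ideal.span fs).minimalPrimes) ?_
    (fun x _ y _ h => vanishingIdeal_singleton_injective h)
    (Ideal.finite_minimalPrimes_of_isNoetherianRing _ _)
  intro x hx
  have hmax := isMaximal_vanishingIdeal_singleton x
  refine ⟨⟨hmax.isPrime, Ideal.span_le.2 fun f hf => ?_⟩, ?_⟩
  · have := hx f hf
    simpa [aeval_eq_eval] using this
  rintro P ⟨hP, hIP⟩ hPm
  exact le_of_le_mul_self_sup hmax.ne_top hP (vanishingIdeal_singleton_le_sup hx (ht x hx)) hIP hPm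

/-- An irreducible plane curve meets a curve not containing it in finitely many points: there is
a finite set of lines through the origin containing all common zeros. -/
lemma finite_common_zeros [Infinite K] {p g : MvPolynomial (Fin 3) K} (hp : Irreducible p)
    (hpg : ¬ p ∣ g) :
    ∃ T : Set (Fin 3 → K), T.Finite ∧ (∀ P ∈ T, P ≠ 0 ∧ eval P p = 0 ∧ eval P g = 0) ∧
      ∀ P, P ≠ 0 → (∀ t : K, eval (t • P) p = 0) → (∀ t : K, eval (t • P) g = 0) →
        ∃ P' ∈ T, ∃ c : K, c ≠ 0 ∧ P = c • P' := by
  classical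
  let Z : Set (Fin 3 → K) :=
    {P | P ≠ 0 ∧ (∀ t : K, eval (t • P) p = 0) ∧ (∀ t : K, eval (t • P) g = 0)}
  let J : (Fin 3 → K) → Ideal (MvPolynomial (Fin 3) K) :=
    fun P => vanishingIdeal K (Set.range fun t : K => t • P)
  have hJmem : ∀ P f, f ∈ J P ↔ ∀ t : K, eval (t • P) f = 0 := by
    intro P f; simp [J, aeval_eq_eval]
  have hJprime : ∀ P, (J P).IsPrime := by
    intro P
    let φ : MvPolynomial (Fin 3) K →ₐ[K] Polynomial K :=
      aeval (fun i => Polynomial.C (P i) * Polynomial.X)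
    have hφ : ∀ f t, (φ f).eval t = eval (t • P) f := by
      intro f t
      simp only [φ]
      rw [← Polynomial.coe_evalRingHom, ← RingHom.coe_coe (aeval _), ← RingHom.comp_apply]
      congr 1
      apply ringHom_ext
      · intro r; simp
      · intro i; simp [mul_comm t]
    have : J P = RingHom.ker φ := by
      ext f
      rw [hJmem, RingHom.mem_ker]
      constructor
      · intro h
        exact Polynomial.funext fun t => by rw [hφ, h]; simp
      · intro h t
        rw [← hφ, h]; simp
    rw [this]
    exact RingHom.ker_isPrime _
  have hmin : ∀ P ∈ Z, J P ∈ (Ideal.span {p, g}).minimalPrimes := by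
    rintro P ⟨hP0, hPp, hPg⟩
    have hle : Ideal.span {p, g} ≤ J P := by
      rw [Ideal.span_le]
      rintro f (rfl | rfl)
      · exact (hJmem _ _).2 hPp
      · exact (hJmem _ _).2 hPg
    have := hJprime P
    obtain ⟨M, hM, hMJ⟩ := Ideal.exists_minimalPrimes_le hle
    have hMprime : M.IsPrime := hM.1.1
    by_contra hnot
    have hlt : M < J P := lt_of_le_of_ne hMJ (fun h => hnot (h ▸ hM))
    have hpp : (Ideal.span {p}).IsPrime := (Ideal.span_singleton_prime hp.ne_zero).2 hp.prime
    have hgM : g ∈ M := hM.1.2 (Ideal.subset_span (by simp))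
    have hpM : p ∈ M := hM.1.2 (Ideal.subset_span (by simp))
    have h1 : (⊥ : Ideal (MvPolynomial (Fin 3) K)) < Ideal.span {p} := by
      rw [bot_lt_iff_ne_bot, Ne, Ideal.span_singleton_eq_bot]
      exact hp.ne_zero
    have h2 : Ideal.span {p} < M := by
      refine lt_of_le_of_ne ((Ideal.span_singleton_le_iff_mem _).2 hpM) ?_
      rintro h
      rw [← h, Ideal.mem_span_singleton] at hgM
      exact hpg hgM
    have h3 : J P < vanishingIdeal K {(0 : Fin 3 → K)} := by
      refine lt_of_le_of_ne ?_ ?_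
      · intro f hf
        have := (hJmem _ _).1 hf 0
        simpa [aeval_eq_eval] using this
      · intro h
        apply hP0
        funext i
        have : X i ∈ J P := by rw [h]; simp
        simpa using (hJmem _ _).1 this 1
    have hmax : (vanishingIdeal K {(0 : Fin 3 → K)}).IsPrime :=
      (isMaximal_vanishingIdeal_singleton _).isPrime
    apply not_strictMono_primeSpectrum (n := 3) (K := K)
      ![⟨⊥, Ideal.isPrime_bot⟩, ⟨_, hpp⟩, ⟨_, hMprime⟩, ⟨_, hJprime P⟩, ⟨_, hmax⟩]
    rw [Fin.strictMono_iff_lt_succ]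
    intro i
    fin_cases i
    · exact h1
    · exact h2
    · exact hlt
    · exact h3
  have hfin : (J '' Z).Finite :=
    (Ideal.finite_minimalPrimes_of_isNoetherianRing _ (Ideal.span {p, g})).subset
      (by rintro _ ⟨P, hP, rfl⟩; exact hmin P hP)
  obtain ⟨T, hTZ, hTfin, hTim⟩ := (Set.exists_subset_image_finite_and (f := J) (s := Z)
    (p := fun t => t = J '' Z)).1 ⟨_, subset_rfl, hfin, rfl⟩
  refine ⟨T, hTfin, fun P hP => ?_, fun P hP0 hPp hPg => ?_⟩
  · obtain ⟨h0, h1, h2⟩ := hTZ hP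
    exact ⟨h0, by simpa using h1 1, by simpa using h2 1⟩
  · have : J P ∈ J '' T := hTim ▸ Set.mem_image_of_mem J (show P ∈ Z from ⟨hP0, hPp, hPg⟩)
    obtain ⟨P', hP', hJ⟩ := this
    obtain ⟨j, hj⟩ := Function.ne_iff.1 (hTZ hP').1
    have hrel : ∀ i, P i * P' j = P j * P' i := by
      intro i
      have h1 : X i * C (P' j) - X j * C (P' i) ∈ J P := by
        rw [← hJ, hJmem]
        intro t
        simp only [map_sub, map_mul, eval_X, eval_C, Pi.smul_apply, smul_eq_mul]
        ring
      have h2 := (hJmem _ _).1 h1 1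
      simpa [sub_eq_zero] using h2
    have hP : P = (P j / P' j) • P' := by
      funext i
      have := hrel i
      simp only [Pi.smul_apply, smul_eq_mul]
      simp only [Pi.zero_apply] at hj
      field_simp
      exact this
    refine ⟨P', hP', P j / P' j, ?_, hP⟩
    intro h0
    rw [h0, zero_smul] at hP
    exact hP0 hP

end Points

section Bilinear

/-- Every quadratic polynomial over an algebraically closed field has a root. -/
lemma exists_quadratic_root [IsAlgClosed K] (a b c : K) (ha : a ≠ 0) :
    ∃ t : K, a * t ^ 2 + b * t + c = 0 := by
  have hdeg := Polynomial.degree_quadratic (b := b) (c := c) ha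
  obtain ⟨t, ht⟩ := IsAlgClosed.exists_root
    (Polynomial.C a * Polynomial.X ^ 2 + Polynomial.C b * Polynomial.X + Polynomial.C c)
    (by rw [hdeg]; decide)
  exact ⟨t, by simpa [Polynomial.IsRoot] using ht⟩

/-- In the hyperplane `y 0 = 0`, a nonzero vector of the kernel of a functional `n` and a vector
on which `n` is `1` can be completed to a basis by an element of the kernel. -/
lemma exists_completion (n : (Fin 4 → K) →ₗ[K] K) {P e : Fin 4 → K} (hP : P ≠ 0) (hP0 : P 0 = 0)
    (hnP : n P = 0) (he0 : e 0 = 0) (hne : n e = 1) :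
    ∃ f : Fin 4 → K, f 0 = 0 ∧ n f = 0 ∧ (∀ a d : K, a • P + d • f = 0 → d = 0) ∧
      ∀ y : Fin 4 → K, y 0 = 0 → ∃ a c d : K, y = a • P + c • e + d • f := by
  let g : (Fin 4 → K) →ₗ[K] K × K := (LinearMap.proj 0).prod n
  have hg : ∀ y, y ∈ LinearMap.ker g ↔ y 0 = 0 ∧ n y = 0 := by
    intro y; simp [g, LinearMap.mem_ker]
  have hsurj : Function.Surjective g := by
    rintro ⟨a, c⟩
    let y : Fin 4 → K := Pi.single 0 a
    refine ⟨y + (c - n y) • e, ?_⟩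
    simp [g, he0, hne, y]
  have hfin : Module.finrank K (LinearMap.ker g) = 2 := by
    have h1 := g.finrank_range_add_finrank_ker
    rw [LinearMap.range_eq_top.2 hsurj, finrank_top] at h1
    simp at h1
    omega
  let P₁ : LinearMap.ker g := ⟨P, (hg P).2 ⟨hP0, hnP⟩⟩
  have hP₁ : P₁ ≠ 0 := fun h => hP (congrArg Subtype.val h)
  obtain ⟨f, hf⟩ := exists_linearIndependent_pair_of_one_lt_finrank (by omega : 1 < Module.finrank K
    (LinearMap.ker g)) hP₁
  have hspan := hf.span_eq_top_of_card_eq_finrank (by simp [hfin])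
  refine ⟨f, ((hg f).1 f.2).1, ((hg f).1 f.2).2, ?_, ?_⟩
  · intro a d h
    exact (LinearIndependent.pair_iff.1 hf a d (Subtype.ext h)).2
  · intro y hy
    have hy' : y - n y • e ∈ LinearMap.ker g := (hg _).2 ⟨by simp [hy, he0], by simp [hne]⟩
    have : (⟨_, hy'⟩ : LinearMap.ker g) ∈ Submodule.span K (Set.range ![P₁, f]) :=
      hspan ▸ Submodule.mem_top
    rw [Matrix.range_cons, Matrix.range_cons, Matrix.range_empty, Set.union_empty,
      Set.singleton_union, Submodule.mem_span_pair] at this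
    obtain ⟨a, d, h⟩ := this
    have h' := congrArg Subtype.val h
    simp only [P₁, Submodule.coe_add, Submodule.coe_smul] at h'
    exact ⟨a, n y, d, by rw [add_right_comm, h']; simp⟩

variable {b B : (Fin 4 → K) →ₗ[K] (Fin 4 → K) →ₗ[K] K}

/-- If an isotropic cone contains no plane then its nonzero points are not in the radical. -/
lemma exists_bilin_ne_zero [IsAlgClosed K] (hb : ∀ x y, b x y = b y x)
    (hline : ∀ P P' : Fin 4 → K, P 0 = 0 → P' 0 = 0 → P ≠ 0 → b P P = 0 → b P P' = 0 →
      b P' P' = 0 → ∃ c : K, P' = c • P)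
    {P : Fin 4 → K} (hP : P ≠ 0) (hP0 : P 0 = 0) (hPP : b P P = 0) :
    ∃ y : Fin 4 → K, y 0 = 0 ∧ b P y ≠ 0 := by
  by_contra! hcon
  obtain ⟨i, hi⟩ := Function.ne_iff.1 hP
  simp only [Pi.zero_apply] at hi
  have hexists : ∃ (e : Fin 4 → K) (n : (Fin 4 → K) →ₗ[K] K), e 0 = 0 ∧ n P = 0 ∧ n e = 1 := by
    obtain ⟨j, hj0, hji⟩ : ∃ j : Fin 4, j ≠ 0 ∧ j ≠ i := by
      by_cases h : i = 1
      · exact ⟨2, by decide, by rw [h]; decide⟩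
      · exact ⟨1, by decide, fun h' => h h'.symm⟩
    refine ⟨Pi.single j 1, (LinearMap.proj j : (Fin 4 → K) →ₗ[K] K) -
      (P j / P i) • LinearMap.proj i, ?_, ?_, ?_⟩
    · simp [hj0.symm]
    · simp [hi]
    · simp [hji.symm]
  obtain ⟨e, n, he0, hnP, hne⟩ := hexists
  obtain ⟨f, hf0, hnf, hfP, -⟩ := exists_completion n hP hP0 hnP he0 hne
  by_cases hee : b e e = 0
  · obtain ⟨c, hc⟩ := hline P e hP0 he0 hP hPP (hcon e he0) hee
    rw [hc] at hne
    simp [hnP] at hne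
  · obtain ⟨t, ht⟩ := exists_quadratic_root (b e e) (2 * b e f) (b f f) hee
    have h0 : (f + t • e) 0 = 0 := by simp [hf0, he0]
    obtain ⟨c, hc⟩ := hline P (f + t • e) hP0 h0 hP hPP (hcon _ h0) (by
      simp only [map_add, map_smul, LinearMap.add_apply, LinearMap.smul_apply, smul_eq_mul]
      rw [hb f e]
      linear_combination ht)
    have ht0 : t = 0 := by
      have := congrArg n hc
      simpa [hnf, hne, hnP] using this
    rw [ht0] at hc
    have := hfP (-c) 1 (by rw [neg_smul, ← hc]; simp)
    exact one_ne_zero this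

/-- The defining equations of the configuration: `R + K P` is a line of the surface
`q² = z² Q` on which `q` is a coordinate. -/
structure IsRulingPair (b B : (Fin 4 → K) →ₗ[K] (Fin 4 → K) →ₗ[K] K) (R P : Fin 4 → K) : Prop where
  R_zero : R 0 = 1
  P_zero : P 0 = 0
  b_PP : b P P = 0
  b_RP : 2 * b R P = 1
  B_PP : B P P = 1
  b_RR : b R R = 0
  B_RR : B R R = 0
  B_RP : B R P = 0

/-- The equations of `IsRulingPair` have no nonzero tangent vectors. -/
lemma IsRulingPair.tangent_eq_zero [IsAlgClosed K] (h2 : (2 : K) ≠ 0)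
    (hb : ∀ x y, b x y = b y x) (hB : ∀ x y, B x y = B y x)
    (hnd : ∀ P : Fin 4 → K, P ≠ 0 → P 0 = 0 → b P P = 0 → ∃ y : Fin 4 → K, y 0 = 0 ∧ b P y ≠ 0)
    (hsm : ∀ v : Fin 4 → K, v 0 = 1 → b v v ^ 2 = B v v →
      ∃ y : Fin 4 → K, y 0 = 0 ∧ 2 * b v v * b v y - B v y ≠ 0)
    {R P R' P' : Fin 4 → K} (h : IsRulingPair b B R P) (hR' : R' 0 = 0) (hP' : P' 0 = 0)
    (e1 : b P P' = 0) (e2 : b R P' + b R' P = 0) (e3 : B P P' = 0) (e4 : b R R' = 0)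
    (e5 : B R R' = 0) (e6 : B R P' + B R' P = 0) : R' = 0 ∧ P' = 0 := by
  obtain ⟨hR0, hP0, hPP, hRP, hBPP, hRR, hBRR, hBRP⟩ := h
  have hP : P ≠ 0 := by rintro rfl; simp at hRP
  obtain ⟨y, hy0, hy⟩ := hnd P hP hP0 hPP
  set n2 : (Fin 4 → K) →ₗ[K] K := (2 : K) • b P with hn2
  obtain ⟨e, he0, hne⟩ : ∃ e : Fin 4 → K, e 0 = 0 ∧ n2 e = 1 := by
    refine ⟨(2 * b P y)⁻¹ • y, by simp [hy0], ?_⟩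
    have : 2 * b P y ≠ 0 := mul_ne_zero h2 hy
    simp only [hn2, map_smul, LinearMap.smul_apply, smul_eq_mul]
    field_simp
  obtain ⟨f, hf0, hnf, -, hspan⟩ := exists_completion n2 hP hP0 (by simp [hn2, hPP]) he0 hne
  simp only [hn2, LinearMap.smul_apply, smul_eq_mul] at hne hnf
  have hPf : b P f = 0 := by simpa [h2] using hnf
  obtain ⟨a, c, d, rfl⟩ := hspan R' hR'
  obtain ⟨a', c', d', rfl⟩ := hspan P' hP'
  simp only [map_add, map_smul, LinearMap.add_apply, LinearMap.smul_apply, smul_eq_mul] at e1 e2 e3 e4 e5 e6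
  have hc' : c' = 0 := by linear_combination 2 * e1 - 2 * a' * hPP - c' * hne - d' * hnf
  subst hc'
  have nosol : ∀ s : K, (- B R e + s * (2 * b R e - B P e) + s ^ 2 = 0) →
      (- B R f + s * (2 * b R f - B P f) = 0) → False := by
    intro s h1 h3
    have hv : b (R + s • P) (R + s • P) = s := by
      simp only [map_add, map_smul, LinearMap.add_apply, LinearMap.smul_apply, smul_eq_mul]
      rw [hb P R]
      linear_combination hRR + s * hRP + s ^ 2 * hPP
    obtain ⟨y, hy0, hy⟩ := hsm (R + s • P) (by simp [hR0, hP0]) (by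
      rw [hv]
      simp only [map_add, map_smul, LinearMap.add_apply, LinearMap.smul_apply, smul_eq_mul]
      rw [hB P R]
      linear_combination -hBRR - 2 * s * hBRP - s ^ 2 * hBPP)
    rw [hv] at hy
    obtain ⟨α, γ, δ, rfl⟩ := hspan y hy0
    apply hy
    simp only [map_add, map_smul, LinearMap.add_apply, LinearMap.smul_apply, smul_eq_mul]
    linear_combination γ * h1 + δ * h3 + γ * s ^ 2 * hne + δ * s ^ 2 * hnf
      + α * (s * hRP - s * hBPP - hBRP + 2 * s ^ 2 * hPP)
  have r0 : c * (- B R e) + d * (- B R f) = 0 := by linear_combination -e5 + a * hBRP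
  have r1 : c * (2 * b R e - B P e) + d * (2 * b R f - B P f) + d' * (- B R f) = 0 := by
    rw [hB e P, hB f P] at e6
    linear_combination 2 * e4 - e6 - a * hRP + a * hBPP + a' * hBRP
  have r2 : c + d' * (2 * b R f - B P f) = 0 := by
    rw [hb e P, hb f P] at e2
    linear_combination 2 * e2 - e3 - a' * hRP - 2 * a * hPP - c * hne - d * hnf + a' * hBPP
  have hcdd : c = 0 ∧ d = 0 ∧ d' = 0 := by
    by_cases hβ : 2 * b R f - B P f = 0
    · have hc : c = 0 := by simpa [hβ] using r2
      have hβ0 : B R f ≠ 0 := by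
        intro h0
        obtain ⟨t, ht⟩ := exists_quadratic_root (1 : K) (2 * b R e - B P e) (- B R e) one_ne_zero
        exact nosol t (by linear_combination ht) (by rw [h0, hβ]; simp)
      refine ⟨hc, ?_, ?_⟩
      · simpa [hc, hβ0] using r0
      · simpa [hc, hβ0, hβ] using r1
    · set β1 := 2 * b R f - B P f with hβ1
      have hs : - B R f + (B R f / β1) * β1 = 0 := by field_simp; ring
      have hα : - B R e + (B R f / β1) * (2 * b R e - B P e) + (B R f / β1) ^ 2 ≠ 0 :=
        fun h => nosol _ h hs
      have hc : c = 0 := by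
        have : c * (- B R e + (B R f / β1) * (2 * b R e - B P e) + (B R f / β1) ^ 2) = 0 := by
          linear_combination r0 + (B R f / β1) * r1 + (B R f / β1) ^ 2 * r2
            - (d + (B R f / β1) * d') * hs
        simpa [hα] using this
      have hd' : d' = 0 := by simpa [hc, hβ] using r2
      have hd : d = 0 := by simpa [hc, hβ, hd'] using r1
      exact ⟨hc, hd, hd'⟩
  obtain ⟨rfl, rfl, rfl⟩ := hcdd
  have hRPne : b R P ≠ 0 := by intro h0; simp [h0] at hRP
  have ha : a = 0 := by simpa [hRPne] using e4
  subst ha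
  have ha' : a' = 0 := by simpa [hRPne] using e2
  subst ha'
  simp

end Bilinear

section Forms

/-- The linear form with given coefficients. -/
noncomputable def linPoly {n : ℕ} (φ : Fin n → K) : MvPolynomial (Fin n) K :=
  ∑ i, C (φ i) * X i

@[simp]
lemma eval_linPoly {n : ℕ} (φ v : Fin n → K) : eval v (linPoly φ) = ∑ i, φ i * v i := by
  simp [linPoly]

lemma isHomogeneous_linPoly {n : ℕ} (φ : Fin n → K) : (linPoly φ).IsHomogeneous 1 :=
  IsHomogeneous.sum _ _ _ fun i _ => by
    simpa using (isHomogeneous_C _ (φ i)).mul (isHomogeneous_X K i)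

lemma linPoly_ne_zero {n : ℕ} {φ : Fin n → K} (h : φ ≠ 0) : linPoly φ ≠ 0 := by
  obtain ⟨i, hi⟩ := Function.ne_iff.1 h
  intro h0
  apply hi
  have := congrArg (eval (Pi.single i 1)) h0
  simpa [Pi.single_apply] using this

lemma not_dvd_of_isHomogeneous_of_lt {σ : Type*} {F G : MvPolynomial σ K} {d e : ℕ}
    (hF : F.IsHomogeneous d) (hG : G.IsHomogeneous e) (hG0 : G ≠ 0) (h : e < d) : ¬ F ∣ G := by
  rintro ⟨g, rfl⟩
  have hF0 : F ≠ 0 := left_ne_zero_of_mul hG0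
  have hg0 : g ≠ 0 := right_ne_zero_of_mul hG0
  have h1 := totalDegree_mul_of_isDomain hF0 hg0
  rw [hF.totalDegree hF0, hG.totalDegree hG0] at h1
  omega

/-- A homogeneous polynomial of degree zero is constant. -/
lemma eq_C_of_isHomogeneous_zero {σ : Type*} {p : MvPolynomial σ K} (hp : p.IsHomogeneous 0) :
    ∃ c, p = C c :=
  ⟨_, totalDegree_eq_zero_iff_eq_C.1 (Nat.le_zero.1 hp.totalDegree_le)⟩

/-- The polynomial `b(x, y)` in variables `x = X ∘ s`, `y = X ∘ t`. -/
noncomputable def bilinPoly {σ : Type*} (b : (Fin 4 → K) →ₗ[K] (Fin 4 → K) →ₗ[K] K)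
    (s t : Fin 4 → σ) : MvPolynomial σ K :=
  ∑ i, ∑ j, C (b (Pi.single i 1) (Pi.single j 1)) * (X (s i) * X (t j))

lemma bilin_eq_sum (b : (Fin 4 → K) →ₗ[K] (Fin 4 → K) →ₗ[K] K) (x y : Fin 4 → K) :
    b x y = ∑ i, ∑ j, b (Pi.single i 1) (Pi.single j 1) * (x i * y j) := by
  conv_lhs => rw [b.pi_apply_eq_sum_univ x, LinearMap.sum_apply]
  refine Finset.sum_congr rfl fun i _ => ?_
  rw [LinearMap.smul_apply, LinearMap.pi_apply_eq_sum_univ _ y, Finset.smul_sum]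
  refine Finset.sum_congr rfl fun j _ => ?_
  have h : ∀ i : Fin 4, (fun j => if i = j then (1 : K) else 0) = Pi.single i 1 := by
    intro i; funext j; simp [Pi.single_apply, eq_comm]
  simp only [h, smul_eq_mul]
  ring

lemma eval_bilinPoly {σ : Type*} (b : (Fin 4 → K) →ₗ[K] (Fin 4 → K) →ₗ[K] K)
    (s t : Fin 4 → σ) (v : σ → K) :
    eval v (bilinPoly b s t) = b (fun i => v (s i)) (fun i => v (t i)) := by
  rw [bilin_eq_sum b]
  simp [bilinPoly]

lemma eval_dirDeriv_bilinPoly {σ : Type*} (b : (Fin 4 → K) →ₗ[K] (Fin 4 → K) →ₗ[K] K)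
    (s t : Fin 4 → σ) (u v : σ → K) :
    eval v (dirDeriv u (bilinPoly b s t)) =
      b (fun i => u (s i)) (fun i => v (t i)) + b (fun i => v (s i)) (fun i => u (t i)) := by
  rw [bilin_eq_sum b, bilin_eq_sum b]
  simp only [bilinPoly, map_sum, eval_dirDeriv_mul, dirDeriv_C, dirDeriv_X, eval_C, eval_X, map_zero,
    mul_zero, add_zero, ← Finset.sum_add_distrib]
  refine Finset.sum_congr rfl fun i _ => Finset.sum_congr rfl fun j _ => ?_
  ring

/-- A quadratic form is given by a symmetric bilinear form. -/
lemma exists_bilinPoly_eq (h2 : (2 : K) ≠ 0) {q : MvPolynomial (Fin 4) K}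
    (hq : q.IsHomogeneous 2) :
    ∃ b : (Fin 4 → K) →ₗ[K] (Fin 4 → K) →ₗ[K] K, (∀ x y, b x y = b y x) ∧
      q = bilinPoly b id id := by
  have h1 : ∀ i j, ∃ m, pderiv j (pderiv i q) = C m := fun i j =>
    eq_C_of_isHomogeneous_zero (hq.pderiv.pderiv)
  choose m hm using h1
  have hE1 : ∀ i, pderiv i q = ∑ j, X j * C (m i j) := by
    intro i
    have := (hq.pderiv (i := i)).sum_X_mul_pderiv
    simp only [hm] at this
    simpa using this.symm
  have hE : 2 * q = ∑ i, X i * ∑ j, X j * C (m i j) := by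
    have := hq.sum_X_mul_pderiv
    simp only [hE1] at this
    simpa [two_mul, two_smul] using this.symm
  have hC : (C (2⁻¹ : K) * 2 : MvPolynomial (Fin 4) K) = 1 := by
    rw [show (2 : MvPolynomial (Fin 4) K) = C 2 from rfl, ← C_mul, inv_mul_cancel₀ h2, C_1]
  obtain ⟨b, hb⟩ : ∃ b : (Fin 4 → K) →ₗ[K] (Fin 4 → K) →ₗ[K] K, ∀ x y,
      b x y = ∑ i, ∑ j, x i * (y j * (4⁻¹ * (m i j + m j i))) :=
    ⟨Matrix.toLinearMap₂' K (Matrix.of fun i j => 4⁻¹ * (m i j + m j i)), fun x y => by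
      simp only [Matrix.toLinearMap₂'_apply, Matrix.of_apply, smul_eq_mul]⟩
  refine ⟨b, ?_, ?_⟩
  · intro x y
    rw [hb, hb, Finset.sum_comm]
    refine Finset.sum_congr rfl fun i _ => Finset.sum_congr rfl fun j _ => ?_
    ring
  · have hsingle : ∀ i j, b (Pi.single i 1) (Pi.single j 1) = 4⁻¹ * (m i j + m j i) := by
      intro i j
      simp [hb, Pi.single_apply]
    simp only [bilinPoly, hsingle, id]
    have h4 : (4 : K) = 2 * 2 := by norm_num
    have hswap : ∑ i, ∑ j, C (m i j) * (X i * X j : MvPolynomial (Fin 4) K) =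
        ∑ i, ∑ j, C (m j i) * (X i * X j) := by
      rw [Finset.sum_comm]
      refine Finset.sum_congr rfl fun i _ => Finset.sum_congr rfl fun j _ => ?_
      ring
    have h3 : 2 * q = ∑ i, ∑ j, C (m i j) * (X i * X j : MvPolynomial (Fin 4) K) := by
      rw [hE]
      simp only [Finset.mul_sum]
      refine Finset.sum_congr rfl fun i _ => Finset.sum_congr rfl fun j _ => ?_
      ring
    have h5 : ∑ i, ∑ j, C (4⁻¹ * (m i j + m j i)) * (X i * X j : MvPolynomial (Fin 4) K) =
        C (4⁻¹) * (2 * q + 2 * q) := by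
      nth_rewrite 2 [h3]
      rw [hswap, h3]
      simp only [← Finset.sum_add_distrib, Finset.mul_sum, map_mul, map_add]
      refine Finset.sum_congr rfl fun i _ => Finset.sum_congr rfl fun j _ => ?_
      ring
    rw [h5, h4, mul_inv, C_mul]
    linear_combination (-q * (C (2⁻¹ : K) * 2 + 1)) * hC

/-- The set of pairs `(R, P)` satisfying the equations of `IsRulingPair` is finite. -/
lemma finite_setOf_isRulingPair [IsAlgClosed K] (h2 : (2 : K) ≠ 0)
    {b B : (Fin 4 → K) →ₗ[K] (Fin 4 → K) →ₗ[K] K}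
    (hb : ∀ x y, b x y = b y x) (hB : ∀ x y, B x y = B y x)
    (hnd : ∀ P : Fin 4 → K, P ≠ 0 → P 0 = 0 → b P P = 0 → ∃ y : Fin 4 → K, y 0 = 0 ∧ b P y ≠ 0)
    (hsm : ∀ v : Fin 4 → K, v 0 = 1 → b v v ^ 2 = B v v →
      ∃ y : Fin 4 → K, y 0 = 0 ∧ 2 * b v v * b v y - B v y ≠ 0) :
    {x : (Fin 4 → K) × (Fin 4 → K) | IsRulingPair b B x.1 x.2}.Finite := by
  let r : Fin 4 → Fin 4 ⊕ Fin 4 := Sum.inl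
  let p : Fin 4 → Fin 4 ⊕ Fin 4 := Sum.inr
  let fs : Set (MvPolynomial (Fin 4 ⊕ Fin 4) K) :=
    {X (r 0) - C 1, X (p 0), bilinPoly b p p, C 2 * bilinPoly b r p - C 1, bilinPoly B p p - C 1,
      bilinPoly b r r, bilinPoly B r r, bilinPoly B r p}
  have hiff : ∀ x : Fin 4 ⊕ Fin 4 → K, (∀ f ∈ fs, eval x f = 0) ↔
      IsRulingPair b B (fun i => x (r i)) (fun i => x (p i)) := by
    intro x
    simp only [fs, Set.mem_insert_iff, Set.mem_singleton_iff, forall_eq_or_imp, forall_eq,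
      map_sub, map_mul, eval_X, eval_C, eval_bilinPoly, sub_eq_zero]
    constructor
    · rintro ⟨h1, h2, h3, h4, h5, h6, h7, h8⟩
      exact ⟨h1, h2, h3, h4, h5, h6, h7, h8⟩
    · rintro ⟨h1, h2, h3, h4, h5, h6, h7, h8⟩
      exact ⟨h1, h2, h3, h4, h5, h6, h7, h8⟩
  have hfin := finite_zeros_of_tangent_eq_zero fs (by
    intro x hx y hy
    have hx' := (hiff x).1 hx
    simp only [fs, Set.mem_insert_iff, Set.mem_singleton_iff, forall_eq_or_imp, forall_eq,
      map_sub, eval_dirDeriv_mul, dirDeriv_X, dirDeriv_C, eval_C, eval_dirDeriv_bilinPoly,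
      map_zero, sub_zero, mul_zero, add_zero] at hy
    obtain ⟨y1, y2, y3, y4, y5, y6, y7, y8⟩ := hy
    have half : ∀ a : K, a + a = 0 → a = 0 := fun a ha => by
      have : 2 * a = 0 := by rw [two_mul, ha]
      simpa [h2] using this
    have := hx'.tangent_eq_zero h2 hb hB hnd hsm (R' := fun i => y (r i)) (P' := fun i => y (p i))
      y1 y2 (half _ (by rw [hb] at y3; exact y3))
      (by rw [add_comm]; exact (mul_eq_zero.1 y4).resolve_left h2)
      (half _ (by rw [hB] at y5; exact y5)) (half _ (by rw [hb] at y6; exact y6))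
      (half _ (by rw [hB] at y7; exact y7)) (by rw [add_comm]; exact y8)
    funext i
    rcases i with i | i
    · exact congrFun this.1 i
    · exact congrFun this.2 i)
  refine (hfin.image fun x => ((fun i => x (r i)), (fun i => x (p i)))).subset ?_
  rintro ⟨R, P⟩ h
  exact ⟨Sum.elim R P, (hiff _).2 h, rfl⟩

end Forms

section Quartic

/-- `L` is a linear subspace contained in the zero set of `F` and meeting every hyperplane
nontrivially. -/
structure IsLineIn (F : MvPolynomial (Fin 4) K) (L : Submodule K (Fin 4 → K)) : Prop where
  eval_eq_zero : ∀ x ∈ L, eval x F = 0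
  exists_mem : ∀ ψ : Fin 4 → K, ∃ P ∈ L, P ≠ 0 ∧ ∑ i, ψ i * P i = 0

lemma IsLineIn.exists_mem_zero {F : MvPolynomial (Fin 4) K} {L : Submodule K (Fin 4 → K)}
    (h : IsLineIn F L) : ∃ P ∈ L, P ≠ 0 ∧ P 0 = 0 := by
  obtain ⟨P, hPL, hP, hP0⟩ := h.exists_mem (Pi.single 0 1)
  exact ⟨P, hPL, hP, by simpa [Pi.single_apply] using hP0⟩

/-- The composition of a polynomial with a translation. -/
noncomputable def translate {σ : Type*} (w : σ → K) (F : MvPolynomial σ K) : MvPolynomial σ K :=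
  bind₁ (fun i => X i + C (w i)) F

@[simp]
lemma eval_translate {σ : Type*} (w v : σ → K) (F : MvPolynomial σ K) :
    eval v (translate w F) = eval (v + w) F := by
  rw [translate, ← coe_aeval_eq_eval, ← coe_aeval_eq_eval, RingHom.coe_coe, RingHom.coe_coe,
    aeval_bind₁]
  congr 2
  funext i
  simp

lemma exists_ne_zero_of_pair (R P : Fin 4 → K) :
    ∃ φ : Fin 4 → K, φ ≠ 0 ∧ ∑ i, φ i * R i = 0 ∧ ∑ i, φ i * P i = 0 := by
  let g : (Fin 4 → K) →ₗ[K] (Fin 2 → K) :=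
    LinearMap.pi ![Fintype.linearCombination K R, Fintype.linearCombination K P]
  have hg : LinearMap.ker g ≠ ⊥ := LinearMap.ker_ne_bot_of_finrank_lt (by simp)
  obtain ⟨φ, hφ, hφ0⟩ := Submodule.exists_mem_ne_zero_of_ne_bot hg
  refine ⟨φ, hφ0, ?_, ?_⟩
  · simpa [g, Fintype.linearCombination_apply] using congrFun hφ 0
  · simpa [g, Fintype.linearCombination_apply] using congrFun hφ 1

/-- An irreducible surface of degree at least two which is covered, away from the plane `x 0 = 0`,
by finitely many lines and by lines in finitely many directions, is invariant under translation in
one of these directions. -/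
lemma exists_translation_invariant [IsAlgClosed K] {F : MvPolynomial (Fin 4) K} {d : ℕ}
    (hF : Irreducible F) (hFd : F.IsHomogeneous d) (hd : 1 < d)
    {T : Set (Fin 4 → K)} (hT : T.Finite) {Λ : Set ((Fin 4 → K) × (Fin 4 → K))} (hΛ : Λ.Finite)
    (hcov : ∀ v : Fin 4 → K, v 0 = 1 → eval v F = 0 →
      (∃ x ∈ Λ, ∃ s : K, v = x.1 + s • x.2) ∨ ∃ P ∈ T, ∀ s : K, eval (v + s • P) F = 0) :
    ∃ P ∈ T, ∀ v, eval v F = 0 → ∀ s : K, eval (v + s • P) F = 0 := by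
  classical
  by_contra! hcon
  choose! w hw s hs using hcon
  choose φ hφ0 hφ1 hφ2 using fun x : (Fin 4 → K) × (Fin 4 → K) => exists_ne_zero_of_pair x.1 x.2
  have hlin : ∀ φ : Fin 4 → K, φ ≠ 0 → ¬ F ∣ linPoly φ := fun φ hφ =>
    not_dvd_of_isHomogeneous_of_lt hFd (isHomogeneous_linPoly φ) (linPoly_ne_zero hφ) hd
  have hdvd : F ∣ linPoly (Pi.single 0 1) * ((∏ P ∈ hT.toFinset, translate (s P • P) F) *
      ∏ x ∈ hΛ.toFinset, linPoly (φ x)) := by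
    refine dvd_of_forall_eval_eq_zero hF fun v hv => ?_
    by_cases hv0 : v 0 = 0
    · simp [Pi.single_apply, hv0]
    have hv' : v = v 0 • ((v 0)⁻¹ • v) := by rw [smul_smul, mul_inv_cancel₀ hv0, one_smul]
    have h1 : eval ((v 0)⁻¹ • v) F = 0 := by
      rw [eval_smul_of_isHomogeneous hFd, hv, mul_zero]
    rw [map_mul, map_mul, map_prod, map_prod]
    rcases hcov ((v 0)⁻¹ • v) (by simp [hv0]) h1 with ⟨x, hx, t, hxt⟩ | ⟨P, hP, hPs⟩
    · rw [Finset.prod_eq_zero (hΛ.mem_toFinset.2 hx), mul_zero, mul_zero]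
      rw [eval_linPoly, hv', hxt]
      have : ∑ i, φ x i * (v 0 • (x.1 + t • x.2)) i =
          v 0 * (∑ i, φ x i * x.1 i + t * ∑ i, φ x i * x.2 i) := by
        rw [Finset.mul_sum, ← Finset.sum_add_distrib, Finset.mul_sum]
        refine Finset.sum_congr rfl fun i _ => ?_
        simp only [Pi.smul_apply, Pi.add_apply, smul_eq_mul]
        ring
      rw [this, hφ1, hφ2]
      simp
    · rw [Finset.prod_eq_zero (hT.mem_toFinset.2 hP), zero_mul, mul_zero]
      have h2 := hPs ((v 0)⁻¹ * s P)
      rw [eval_translate]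
      have h3 : v + s P • P = v 0 • ((v 0)⁻¹ • v + ((v 0)⁻¹ * s P) • P) := by
        rw [smul_add, ← hv', smul_smul, mul_inv_cancel_left₀ hv0]
      rw [h3, eval_smul_of_isHomogeneous hFd, h2, mul_zero]
  rcases hF.prime.dvd_or_dvd hdvd with h | h
  · exact hlin _ (by simp) h
  rcases hF.prime.dvd_or_dvd h with h | h
  · obtain ⟨P, hP, g, hg⟩ := (Prime.dvd_finsetProd_iff hF.prime _).1 h
    have hP' := hT.mem_toFinset.1 hP
    apply hs P hP'
    rw [← eval_translate, hg, map_mul, hw P hP', zero_mul]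
  · obtain ⟨x, hx, h⟩ := (Prime.dvd_finsetProd_iff hF.prime _).1 h
    exact hlin _ (hφ0 x) h

/-- An irreducible plane conic contains no line. -/
lemma exists_smul_eq_of_line [Infinite K] {p : MvPolynomial (Fin 3) K}
    (hp : Irreducible p) (hp2 : p.IsHomogeneous 2) {P P' : Fin 3 → K} (hP : P ≠ 0)
    (h : ∀ s t : K, eval (t • (P' + s • P)) p = 0) : ∃ c : K, P' = c • P := by
  by_contra! hcon
  obtain ⟨φ, hφ, h1, h2⟩ : ∃ φ : Fin 3 → K, φ ≠ 0 ∧ ∑ i, φ i * P i = 0 ∧ ∑ i, φ i * P' i = 0 := by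
    let g : (Fin 3 → K) →ₗ[K] (Fin 2 → K) :=
      LinearMap.pi ![Fintype.linearCombination K P, Fintype.linearCombination K P']
    have hg : LinearMap.ker g ≠ ⊥ := LinearMap.ker_ne_bot_of_finrank_lt (by simp)
    obtain ⟨φ, hφ, hφ0⟩ := Submodule.exists_mem_ne_zero_of_ne_bot hg
    refine ⟨φ, hφ0, ?_, ?_⟩
    · simpa [g, Fintype.linearCombination_apply] using congrFun hφ 0
    · simpa [g, Fintype.linearCombination_apply] using congrFun hφ 1
  obtain ⟨T, hT, -, hTc⟩ := finite_common_zeros hp (not_dvd_of_isHomogeneous_of_lt hp2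
    (isHomogeneous_linPoly φ) (linPoly_ne_zero hφ) one_lt_two)
  have hall : ∀ s : K, ∃ Q ∈ T, ∃ c : K, c ≠ 0 ∧ P' + s • P = c • Q := by
    intro s
    refine hTc _ ?_ (h s) ?_
    · intro h0
      exact hcon (-s) (by rw [neg_smul]; exact eq_neg_of_add_eq_zero_left h0)
    · intro t
      rw [eval_linPoly]
      have : ∑ i, φ i * (t • (P' + s • P)) i = t * (∑ i, φ i * P' i + s * ∑ i, φ i * P i) := by
        rw [Finset.mul_sum, ← Finset.sum_add_distrib, Finset.mul_sum]
        refine Finset.sum_congr rfl fun i _ => ?_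
        simp only [Pi.smul_apply, Pi.add_apply, smul_eq_mul]
        ring
      rw [this, h1, h2]
      simp
  choose Q hQ c hc hQc using hall
  have : Finite T := hT
  obtain ⟨s, s', hss, hQQ⟩ := Finite.exists_ne_map_eq_of_infinite (fun s => (⟨Q s, hQ s⟩ : T))
  have hQQ' : Q s = Q s' := congrArg Subtype.val hQQ
  have e : c s' • (P' + s • P) = c s • (P' + s' • P) := by
    rw [hQc s, hQc s', hQQ', smul_smul, smul_smul, mul_comm]
  by_cases hcc : c s' = c s
  · rw [hcc] at e
    have e' := smul_right_injective _ (hc s) e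
    have : (s - s') • P = 0 := by rw [sub_smul, sub_eq_zero]; exact add_left_cancel e'
    rcases smul_eq_zero.1 this with h | h
    · exact hss (sub_eq_zero.1 h)
    · exact hP h
  · apply hcon ((c s' - c s)⁻¹ * (c s * s' - c s' * s))
    have hcc' : c s' - c s ≠ 0 := sub_ne_zero.2 hcc
    have : (c s' - c s) • P' = (c s * s' - c s' * s) • P := by
      funext i
      have := congrFun e i
      simp only [Pi.smul_apply, Pi.add_apply, smul_eq_mul] at this ⊢
      linear_combination this
    rw [mul_smul, ← this, smul_smul, inv_mul_cancel₀ hcc', one_smul]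

/-- A polynomial function of degree at most four that vanishes identically has zero
coefficients. -/
lemma coeff_eq_zero_of_quartic [Infinite K] {a0 a1 a2 a3 a4 : K}
    (h : ∀ s : K, a0 + a1 * s + a2 * s ^ 2 + a3 * s ^ 3 + a4 * s ^ 4 = 0) :
    a0 = 0 ∧ a1 = 0 ∧ a2 = 0 ∧ a3 = 0 ∧ a4 = 0 := by
  have hp : (Polynomial.C a0 + Polynomial.C a1 * Polynomial.X + Polynomial.C a2 * Polynomial.X ^ 2 +
      Polynomial.C a3 * Polynomial.X ^ 3 + Polynomial.C a4 * Polynomial.X ^ 4) = 0 :=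
    Polynomial.funext fun s => by simpa using h s
  have hc := fun n => congrArg (fun p : Polynomial K => p.coeff n) hp
  refine ⟨?_, ?_, ?_, ?_, ?_⟩
  · simpa using hc 0
  · simpa [Polynomial.coeff_X, Polynomial.coeff_C, Polynomial.coeff_X_pow] using hc 1
  · simpa [Polynomial.coeff_X, Polynomial.coeff_C, Polynomial.coeff_X_pow] using hc 2
  · simpa [Polynomial.coeff_X, Polynomial.coeff_C, Polynomial.coeff_X_pow] using hc 3
  · simpa [Polynomial.coeff_X, Polynomial.coeff_C, Polynomial.coeff_X_pow] using hc 4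

end Quartic

section Ruled

/-- The quartic surface `q² = z² Q`, where `q = b(x, x)` restricts to an irreducible conic `p` on
the plane `z = x 0 = 0` and `Q = B(x, x)`, covered by lines which have no common point and having
no singular points off the plane. -/
structure IsRuledQuartic (b B : (Fin 4 → K) →ₗ[K] (Fin 4 → K) →ₗ[K] K)
    (p : MvPolynomial (Fin 3) K) (F : MvPolynomial (Fin 4) K) : Prop where
  two_ne_zero : (2 : K) ≠ 0
  symm_b : ∀ x y, b x y = b y x
  symm_B : ∀ x y, B x y = B y x
  irreducible_p : Irreducible p
  isHomogeneous_p : p.IsHomogeneous 2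
  eval_p : ∀ P : Fin 3 → K, eval P p = b (Fin.cons 0 P) (Fin.cons 0 P)
  irreducible : Irreducible F
  isHomogeneous : F.IsHomogeneous 4
  eval_F : ∀ v, eval v F = b v v ^ 2 - v 0 ^ 2 * B v v
  exists_line : ∀ v, v ≠ 0 → eval v F = 0 → ∃ L, IsLineIn F L ∧ v ∈ L
  not_cone : ∀ v, v ≠ 0 → ∃ L, IsLineIn F L ∧ v ∉ L
  smooth : ∀ v : Fin 4 → K, v 0 = 1 → b v v ^ 2 = B v v →
      ∃ y : Fin 4 → K, y 0 = 0 ∧ 2 * b v v * b v y - B v y ≠ 0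

namespace IsRuledQuartic

variable {b B : (Fin 4 → K) →ₗ[K] (Fin 4 → K) →ₗ[K] K} {p : MvPolynomial (Fin 3) K}
  {F : MvPolynomial (Fin 4) K}

lemma cons_tail {n : ℕ} {x : Fin (n + 1) → K} (hx : x 0 = 0) :
    (Fin.cons 0 (Fin.tail x) : Fin (n + 1) → K) = x := by
  rw [← hx, Fin.cons_self_tail]

lemma eval_tail (h : IsRuledQuartic b B p F) {P : Fin 4 → K} (hP : P 0 = 0) :
    eval (Fin.tail P) p = b P P := by
  rw [h.eval_p, cons_tail hP]

lemma tail_ne_zero {P : Fin 4 → K} (hP : P ≠ 0) (hP0 : P 0 = 0) : Fin.tail P ≠ 0 := by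
  intro h0
  apply hP
  rw [← cons_tail hP0, h0]
  funext i
  refine Fin.cases ?_ (fun j => ?_) i <;> simp

lemma exists_smul_eq [IsAlgClosed K] (h : IsRuledQuartic b B p F) (P P' : Fin 4 → K)
    (hP0 : P 0 = 0) (hP'0 : P' 0 = 0) (hP : P ≠ 0) (h1 : b P P = 0) (h2 : b P P' = 0)
    (h3 : b P' P' = 0) : ∃ c : K, P' = c • P := by
  have : Infinite K := IsAlgClosed.instInfinite
  obtain ⟨c, hc⟩ := exists_smul_eq_of_line h.irreducible_p h.isHomogeneous_p
    (tail_ne_zero hP hP0) (P' := Fin.tail P') (by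
      intro s t
      have : t • (Fin.tail P' + s • Fin.tail P) = Fin.tail (t • (P' + s • P)) := rfl
      rw [this, h.eval_tail (by simp [hP0, hP'0])]
      simp only [map_add, map_smul, LinearMap.add_apply, LinearMap.smul_apply, smul_eq_mul]
      rw [h.symm_b P' P, h1, h2, h3]
      simp)
  refine ⟨c, ?_⟩
  rw [← cons_tail hP0, ← cons_tail hP'0, hc]
  funext i
  refine Fin.cases ?_ (fun j => ?_) i <;> simp

/-- The surface cannot be covered by finitely many lines and by lines whose directions lie on a
curve not containing the conic. -/
lemma false_of_cover [IsAlgClosed K] (h : IsRuledQuartic b B p F) {G : MvPolynomial (Fin 3) K}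
    {e : ℕ} (hG : G.IsHomogeneous e) (hpG : ¬ p ∣ G)
    {Λ : Set ((Fin 4 → K) × (Fin 4 → K))} (hΛ : Λ.Finite)
    (hcov : ∀ v : Fin 4 → K, v 0 = 1 → eval v F = 0 →
      (∃ x ∈ Λ, ∃ s : K, v = x.1 + s • x.2) ∨ ∃ P : Fin 4 → K, P ≠ 0 ∧ P 0 = 0 ∧ b P P = 0 ∧
        eval (Fin.tail P) G = 0 ∧ ∀ s : K, eval (v + s • P) F = 0) : False := by
  have : Infinite K := IsAlgClosed.instInfinite
  obtain ⟨T, hT, hTz, hTc⟩ := finite_common_zeros h.irreducible_p hpG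
  obtain ⟨P, ⟨P₁, hP₁, rfl⟩, hP⟩ := exists_translation_invariant h.irreducible h.isHomogeneous
    (by norm_num) (hT.image fun P => (Fin.cons 0 P : Fin 4 → K)) hΛ (by
      intro v hv0 hv
      refine (hcov v hv0 hv).imp_right ?_
      rintro ⟨P, hP, hP0, hbP, hGP, hs⟩
      obtain ⟨P', hP', c, hc, hPc⟩ := hTc (Fin.tail P) (tail_ne_zero hP hP0)
        (fun t => by
          rw [eval_smul_of_isHomogeneous h.isHomogeneous_p, h.eval_tail hP0, hbP, mul_zero])
        (fun t => by rw [eval_smul_of_isHomogeneous hG, hGP, mul_zero])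
      refine ⟨_, Set.mem_image_of_mem _ hP', fun s => ?_⟩
      have h1 := hs (c⁻¹ * s)
      rwa [← cons_tail hP0, hPc, mul_comm, mul_smul, show c⁻¹ • (Fin.cons 0 (c • P') : Fin 4 → K) =
        Fin.cons 0 P' by
          funext i
          refine Fin.cases ?_ (fun j => ?_) i <;> simp [hc]] at h1)
  obtain ⟨hP₁0, hP₁p, -⟩ := hTz P₁ hP₁
  set P : Fin 4 → K := Fin.cons 0 P₁ with hPdef
  have hP0 : P 0 = 0 := rfl
  have hPne : P ≠ 0 := by
    intro h0
    apply hP₁0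
    funext i
    exact congrFun h0 i.succ
  have hPP : b P P = 0 := by rw [← h.eval_p, hP₁p]
  obtain ⟨L, hL, hPL⟩ := h.not_cone P hPne
  obtain ⟨P', hP'L, hP', hP'0⟩ := hL.exists_mem_zero
  have h0 : ∀ s : K, b (P' + s • P) (P' + s • P) = 0 := by
    intro s
    have := hP P' (hL.eval_eq_zero P' hP'L) s
    rw [h.eval_F] at this
    simpa [hP'0, hP0] using this
  have hself : b P' P' = 0 := by simpa using h0 0
  have hPP' : b P P' = 0 := by
    have := h0 1
    simp only [map_add, map_smul, LinearMap.add_apply, LinearMap.smul_apply, smul_eq_mul] at this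
    rw [hself, hPP, h.symm_b P' P] at this
    have h2 : 2 * b P P' = 0 := by linear_combination this
    simpa [h.two_ne_zero] using h2
  obtain ⟨c, hc⟩ := h.exists_smul_eq P P' hP0 hP'0 hPne hPP hPP' hself
  have hc0 : c ≠ 0 := by rintro rfl; simp at hc; exact hP' hc
  apply hPL
  rw [show P = c⁻¹ • P' by rw [hc, smul_smul, inv_mul_cancel₀ hc0, one_smul]]
  exact L.smul_mem _ hP'L

/-- Through each point off the plane `x 0 = 0` there is a line in the surface. -/
lemma exists_direction [IsAlgClosed K] (h : IsRuledQuartic b B p F) {v : Fin 4 → K}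
    (hv0 : v 0 = 1) (hv : eval v F = 0) :
    ∃ P : Fin 4 → K, P ≠ 0 ∧ P 0 = 0 ∧ (∀ s : K, eval (v + s • P) F = 0) ∧
      b v v ^ 2 = B v v ∧ B v P = 2 * b v v * b v P ∧ B P P = 4 * b v P ^ 2 ∧ b P P = 0 := by
  have : Infinite K := IsAlgClosed.instInfinite
  obtain ⟨L, hL, hvL⟩ := h.exists_line v (by rintro rfl; simp at hv0) hv
  obtain ⟨P, hPL, hP, hP0⟩ := hL.exists_mem_zero
  have hs : ∀ s : K, eval (v + s • P) F = 0 := fun s =>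
    hL.eval_eq_zero _ (L.add_mem hvL (L.smul_mem s hPL))
  have h1 : ∀ s : K, (b v v ^ 2 - B v v) + (4 * b v v * b v P - 2 * B v P) * s +
      (4 * b v P ^ 2 + 2 * b v v * b P P - B P P) * s ^ 2 + (4 * b v P * b P P) * s ^ 3 +
      b P P ^ 2 * s ^ 4 = 0 := by
    intro s
    have := hs s
    rw [h.eval_F] at this
    simp only [map_add, map_smul, LinearMap.add_apply, LinearMap.smul_apply, smul_eq_mul,
      Pi.add_apply, Pi.smul_apply, hv0, hP0] at this
    rw [h.symm_b P v, h.symm_B P v] at this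
    linear_combination this
  obtain ⟨a0, a1, a2, -, a4⟩ := coeff_eq_zero_of_quartic h1
  have hbP : b P P = 0 := by simpa using a4
  refine ⟨P, hP, hP0, hs, sub_eq_zero.1 a0, ?_, ?_, hbP⟩
  · have : 2 * (B v P - 2 * b v v * b v P) = 0 := by linear_combination -a1
    exact sub_eq_zero.1 (by simpa [h.two_ne_zero] using this)
  · linear_combination -a2 + 2 * b v v * hbP

/-- Either the line is one of the finitely many special ones, or `Q` vanishes at its point at
infinity. -/
lemma exists_isRulingPair_or [IsAlgClosed K] (h : IsRuledQuartic b B p F) {v : Fin 4 → K}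
    (hv0 : v 0 = 1) (hv : eval v F = 0) :
    (∃ R P : Fin 4 → K, IsRulingPair b B R P ∧ ∃ s : K, v = R + s • P) ∨
      ∃ P : Fin 4 → K, P ≠ 0 ∧ P 0 = 0 ∧ b P P = 0 ∧ B P P = 0 ∧
        ∀ s : K, eval (v + s • P) F = 0 := by
  obtain ⟨P, hP, hP0, hs, e0, e1, e2, e3⟩ := h.exists_direction hv0 hv
  by_cases hvP : b v P = 0
  · exact Or.inr ⟨P, hP, hP0, e3, by rw [e2, hvP]; simp, hs⟩
  · left
    obtain ⟨c, hc⟩ : ∃ c : K, c * (2 * b v P) = 1 :=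
      ⟨_, inv_mul_cancel₀ (mul_ne_zero h.two_ne_zero hvP)⟩
    have hbP := h.symm_b P v
    have hBP := h.symm_B P v
    refine ⟨v - b v v • c • P, c • P, ⟨?_, ?_, ?_, ?_, ?_, ?_, ?_, ?_⟩, b v v, by simp⟩
    · simp [hv0, hP0]
    · simp [hP0]
    all_goals
      simp only [map_sub, map_smul, LinearMap.sub_apply, LinearMap.smul_apply, smul_eq_mul, hbP,
        hBP, e1, e2, e3]
    · ring
    · linear_combination hc
    · linear_combination (c * 2 * b v P + 1) * hc
    · linear_combination (-b v v) * hc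
    · linear_combination -e0 + b v v ^ 2 * (c * 2 * b v P - 1) * hc
    · linear_combination (-2 * b v v * c * b v P) * hc

/-- Such a surface does not exist. -/
theorem elim [IsAlgClosed K] (h : IsRuledQuartic b B p F) : False := by
  have : Infinite K := IsAlgClosed.instInfinite
  have h2 := h.two_ne_zero
  -- restriction of `Q` to the plane
  let i3 : Fin 4 → MvPolynomial (Fin 3) K := Fin.cons 0 X
  let G : MvPolynomial (Fin 3) K := aeval i3 (bilinPoly B id id)
  have hGeval : ∀ P : Fin 3 → K, eval P G = B (Fin.cons 0 P) (Fin.cons 0 P) := by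
    intro P
    have h1 : eval P G = eval (Fin.cons 0 P : Fin 4 → K) (bilinPoly B id id) := by
      simp only [G]
      rw [← RingHom.coe_coe (aeval i3), ← RingHom.comp_apply]
      congr 1
      apply ringHom_ext
      · intro r; simp
      · intro i
        refine Fin.cases ?_ (fun j => ?_) i <;> simp [i3]
    rw [h1, eval_bilinPoly]
    rfl
  have hGhom : G.IsHomogeneous 2 := by
    have hi3 : ∀ i, (i3 i).IsHomogeneous 1 := fun i =>
      Fin.cases (isHomogeneous_zero _ _ _) (fun j => isHomogeneous_X K j) i
    simp only [G, bilinPoly, map_sum, map_mul, aeval_X, id, ← algebraMap_eq, AlgHom.commutes]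
    refine IsHomogeneous.sum _ _ _ fun i _ => IsHomogeneous.sum _ _ _ fun j _ => ?_
    simpa using (isHomogeneous_C _ _).mul ((hi3 i).mul (hi3 j))
  have hpG : p ∣ G := by
    by_contra hpG
    refine h.false_of_cover hGhom hpG (finite_setOf_isRulingPair h2 h.symm_b h.symm_B
      (fun P hP hP0 hPP => exists_bilin_ne_zero h.symm_b h.exists_smul_eq hP hP0 hPP)
      h.smooth) ?_
    intro v hv0 hv
    rcases h.exists_isRulingPair_or hv0 hv with ⟨R, P, hRP, s, hs⟩ | ⟨P, hP, hP0, hbP, hBP, hs⟩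
    · exact Or.inl ⟨(R, P), hRP, s, hs⟩
    · exact Or.inr ⟨P, hP, hP0, hbP, by rw [hGeval, cons_tail hP0, hBP], hs⟩
  obtain ⟨g, hg⟩ := hpG
  obtain ⟨c, rfl⟩ := eq_C_of_isHomogeneous_zero (isHomogeneous_of_mul_left
    h.irreducible_p.ne_zero h.isHomogeneous_p (g := g) (d := 0) (hg ▸ hGhom))
  set D : (Fin 4 → K) →ₗ[K] (Fin 4 → K) →ₗ[K] K := B - c • b with hD
  have hDapp : ∀ x y, D x y = B x y - c * b x y := fun x y => by simp [hD]
  have hDsymm : ∀ x y, D x y = D y x := fun x y => by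
    rw [hDapp, hDapp, h.symm_b, h.symm_B]
  have hDdiag : ∀ y : Fin 4 → K, y 0 = 0 → D y y = 0 := by
    intro y hy
    have h1 := hGeval (Fin.tail y)
    rw [hg, cons_tail hy, map_mul, h.eval_tail hy, eval_C] at h1
    rw [hDapp]
    linear_combination -h1
  have hDplane : ∀ x y : Fin 4 → K, x 0 = 0 → y 0 = 0 → D x y = 0 := by
    intro x y hx hy
    have h1 := hDdiag (x + y) (by simp [hx, hy])
    simp only [map_add, LinearMap.add_apply] at h1
    rw [hDdiag x hx, hDdiag y hy, hDsymm y x] at h1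
    have h3 : 2 * D x y = 0 := by linear_combination h1
    simpa [h2] using h3
  let e0 : Fin 4 → K := Pi.single 0 1
  let φ : Fin 3 → K := fun i => D e0 (Pi.single i.succ 1)
  have hφ : ∀ P : Fin 4 → K, P 0 = 0 → ∑ i, φ i * Fin.tail P i = D e0 P := by
    intro P hP0
    conv_rhs => rw [LinearMap.pi_apply_eq_sum_univ _ P, Fin.sum_univ_succ, hP0, zero_smul, zero_add]
    refine Finset.sum_congr rfl fun i _ => ?_
    have : (fun j => if i.succ = j then (1 : K) else 0) = Pi.single i.succ 1 := by
      funext j; simp [Pi.single_apply, eq_comm]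
    simp only [this, smul_eq_mul, φ, Fin.tail]
    ring
  have hdecomp : ∀ v : Fin 4 → K, (v - v 0 • e0) 0 = 0 := fun v => by simp [e0]
  have hφ0 : φ = 0 := by
    by_contra hφ0
    refine h.false_of_cover (isHomogeneous_linPoly φ) (not_dvd_of_isHomogeneous_of_lt
      h.isHomogeneous_p (isHomogeneous_linPoly φ) (linPoly_ne_zero hφ0) one_lt_two)
      Set.finite_empty ?_
    intro v hv0 hv
    right
    obtain ⟨P, hP, hP0, hs, -, r1, r2, r3⟩ := h.exists_direction hv0 hv
    refine ⟨P, hP, hP0, r3, ?_, hs⟩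
    have h1 := hDdiag P hP0
    rw [hDapp, r2, r3] at h1
    have h4 : b v P = 0 := by
      have : (2 * b v P) ^ 2 = 0 := by linear_combination h1
      simpa [h2] using this
    have h3 : D v P = 0 := by rw [hDapp, r1, h4]; simp
    rw [eval_linPoly, hφ P hP0]
    have h5 := hDplane _ P (hdecomp v) hP0
    rw [map_sub, LinearMap.sub_apply, h3, hv0, one_smul] at h5
    linear_combination -h5
  have hQ : ∀ v : Fin 4 → K, B v v = c * b v v + D e0 e0 * v 0 ^ 2 := by
    intro v
    have h1 : D e0 (v - v 0 • e0) = 0 := by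
      rw [← hφ _ (hdecomp v), hφ0]; simp
    have h3 := hDdiag _ (hdecomp v)
    have h5 : D v v = D e0 e0 * v 0 ^ 2 := by
      simp only [map_sub, map_smul, LinearMap.sub_apply, LinearMap.smul_apply, smul_eq_mul]
        at h1 h3
      rw [hDsymm v e0] at h3
      linear_combination h3 + 2 * v 0 * h1
    linear_combination h5 - hDapp v v
  obtain ⟨t, ht⟩ := exists_quadratic_root (1 : K) (-c) (- D e0 e0) one_ne_zero
  have hfac : F = (bilinPoly b id id - C t * X 0 ^ 2) *
      (bilinPoly b id id - C (c - t) * X 0 ^ 2) := by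
    apply MvPolynomial.funext
    intro v
    rw [h.eval_F, hQ]
    simp only [map_mul, map_sub, map_pow, eval_X, eval_C, eval_bilinPoly, id]
    linear_combination (v 0 ^ 4) * ht
  have hunit : ∀ a : K, ¬ IsUnit (bilinPoly b id id - C a * X 0 ^ 2) := by
    intro a hu
    have h1 := hu.map (eval (0 : Fin 4 → K))
    have h3 : eval 0 (bilinPoly b id id) = 0 := by
      rw [eval_bilinPoly]
      exact map_zero _
    rw [map_sub, h3] at h1
    simp at h1
  rcases h.irreducible.isUnit_or_isUnit hfac with hu | hu
  · exact hunit _ hu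
  · exact hunit _ hu

end IsRuledQuartic
end Ruled

section LinSubst

/-- The composition of a polynomial function with a linear map. -/
noncomputable def linSubst {n m : ℕ} (g : (Fin n → K) →ₗ[K] (Fin m → K)) :
    MvPolynomial (Fin m) K →ₐ[K] MvPolynomial (Fin n) K :=
  aeval fun i => linPoly fun j => g (Pi.single j 1) i

lemma map_eq_sum_single {n m : ℕ} (g : (Fin n → K) →ₗ[K] (Fin m → K)) (v : Fin n → K) (i : Fin m) :
    ∑ j, g (Pi.single j 1) i * v j = g v i := by
  conv_rhs => rw [g.pi_apply_eq_sum_univ v, Finset.sum_apply]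
  refine Finset.sum_congr rfl fun j _ => ?_
  have : (fun k => if j = k then (1 : K) else 0) = Pi.single j 1 := by
    funext k; simp [Pi.single_apply, eq_comm]
  simp only [this, Pi.smul_apply, smul_eq_mul]
  ring

@[simp]
lemma eval_linSubst {n m : ℕ} (g : (Fin n → K) →ₗ[K] (Fin m → K)) (v : Fin n → K)
    (F : MvPolynomial (Fin m) K) : eval v (linSubst g F) = eval (g v) F := by
  induction F using MvPolynomial.induction_on with
  | C a => simp [linSubst]
  | add p q hp hq => simp [hp, hq]
  | mul_X p i hp =>
    rw [map_mul, map_mul, map_mul, hp]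
    simp [linSubst, map_eq_sum_single]

lemma dirDeriv_linPoly {n : ℕ} (φ u : Fin n → K) :
    dirDeriv u (linPoly φ) = C (∑ i, φ i * u i) := by
  simp only [linPoly, map_sum]
  refine Finset.sum_congr rfl fun i _ => ?_
  rw [Derivation.leibniz]
  simp

lemma eval_dirDeriv_linSubst {n m : ℕ} (g : (Fin n → K) →ₗ[K] (Fin m → K)) (u v : Fin n → K)
    (F : MvPolynomial (Fin m) K) :
    eval v (dirDeriv u (linSubst g F)) = eval (g v) (dirDeriv (g u) F) := by
  induction F using MvPolynomial.induction_on with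
  | C a => simp [linSubst]
  | add p q hp hq => simp [hp, hq]
  | mul_X p i hp =>
    rw [map_mul, eval_dirDeriv_mul, eval_dirDeriv_mul, hp]
    have hX : linSubst g (X i) = linPoly fun j => g (Pi.single j 1) i := by simp [linSubst]
    rw [hX]
    simp only [eval_linSubst, dirDeriv_linPoly, map_eq_sum_single, eval_C,
      dirDeriv_X, eval_X, eval_linPoly]

lemma isHomogeneous_linSubst {n m : ℕ} (g : (Fin n → K) →ₗ[K] (Fin m → K))
    {F : MvPolynomial (Fin m) K} {d : ℕ} (hF : F.IsHomogeneous d) :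
    (linSubst g F).IsHomogeneous d := by
  have := hF.aeval (fun i => linPoly fun j => g (Pi.single j 1) i)
    (fun i => isHomogeneous_linPoly _)
  simpa [linSubst] using this

lemma dirDeriv_eq_sum {n : ℕ} (u : Fin n → K) (F : MvPolynomial (Fin n) K) :
    dirDeriv u F = ∑ i, C (u i) * pderiv i F := by
  induction F using MvPolynomial.induction_on with
  | C a => simp
  | add p q hp hq => simp [hp, hq, mul_add, Finset.sum_add_distrib]
  | mul_X p i hp =>
    simp only [Derivation.leibniz, hp, dirDeriv_X, smul_eq_mul, mul_add, Finset.sum_add_distrib,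
      pderiv_X, Pi.single_apply, mul_ite, mul_one, mul_zero, Finset.sum_ite_eq, Finset.mem_univ,
      if_true, Finset.mul_sum]
    congr 1
    · exact mul_comm _ _
    · exact Finset.sum_congr rfl fun j _ => by ring

lemma isHomogeneous_dirDeriv {n : ℕ} (u : Fin n → K) {F : MvPolynomial (Fin n) K} {d : ℕ}
    (hF : F.IsHomogeneous d) : (dirDeriv u F).IsHomogeneous (d - 1) := by
  rw [dirDeriv_eq_sum]
  refine IsHomogeneous.sum _ _ _ fun i _ => ?_
  simpa using (isHomogeneous_C _ (u i)).mul (hF.pderiv (i := i))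

/-- A linear form is given by its coefficients. -/
lemma exists_eq_linPoly {n : ℕ} {p : MvPolynomial (Fin n) K} (hp : p.IsHomogeneous 1) :
    ∃ φ, p = linPoly φ := by
  have h1 : ∀ i, ∃ m, pderiv i p = C m := fun i => eq_C_of_isHomogeneous_zero hp.pderiv
  choose m hm using h1
  refine ⟨m, ?_⟩
  have := hp.sum_X_mul_pderiv
  simp only [hm, one_smul] at this
  rw [← this, linPoly]
  exact Finset.sum_congr rfl fun i _ => mul_comm _ _

end LinSubst

section PlaneCurve

attribute [local instance] MvPolynomial.gradedAlgebra

/-- A homogeneous polynomial vanishing on an irreducible plane curve is divisible by any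
irreducible homogeneous polynomial vanishing on the curve. -/
lemma dvd_of_forall_mem_eval_eq_zero [Infinite K] {D : Set (Fin 3 → K)}
    (hJ : (vanishingIdeal K D).IsPrime) (hD0 : ∀ P ∈ D, P ≠ 0)
    (hspan : ∀ ψ : Fin 3 → K, (∀ P ∈ D, ∑ i, ψ i * P i = 0) → ψ = 0)
    {p g : MvPolynomial (Fin 3) K} {e e' : ℕ} (hp : Irreducible p) (hpe : p.IsHomogeneous e)
    (hpD : ∀ P ∈ D, eval P p = 0) (hge : g.IsHomogeneous e') (hgD : ∀ P ∈ D, eval P g = 0) :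
    p ∣ g := by
  classical
  by_contra hpg
  obtain ⟨T, hT, -, hTc⟩ := finite_common_zeros hp hpg
  have hex : ∀ t : Fin 3 → K, ∃ ψ : Fin 3 → K, ∑ i, ψ i * t i = 0 ∧
      linPoly ψ ∉ vanishingIdeal K D := by
    intro t
    have hker : LinearMap.ker (Fintype.linearCombination K t) ≠ ⊥ :=
      LinearMap.ker_ne_bot_of_finrank_lt (by simp)
    obtain ⟨ψ, hψ, hψ0⟩ := Submodule.exists_mem_ne_zero_of_ne_bot hker
    refine ⟨ψ, by simpa [Fintype.linearCombination_apply] using hψ, fun hmem => hψ0 (hspan ψ ?_)⟩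
    intro P hP
    have := hmem P hP
    rwa [aeval_eq_eval, eval_linPoly] at this
  choose ψ hψ hψD using hex
  have hprod : ∏ t ∈ hT.toFinset, linPoly (ψ t) ∈ vanishingIdeal K D := by
    intro P hP
    rw [aeval_eq_eval, map_prod]
    obtain ⟨P', hP', c, -, hPc⟩ := hTc P (hD0 P hP)
      (fun t => by rw [eval_smul_of_isHomogeneous hpe, hpD P hP, mul_zero])
      (fun t => by rw [eval_smul_of_isHomogeneous hge, hgD P hP, mul_zero])
    refine Finset.prod_eq_zero (hT.mem_toFinset.2 hP') ?_
    rw [hPc, eval_smul_of_isHomogeneous (isHomogeneous_linPoly _), eval_linPoly, hψ, mul_zero]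
  obtain ⟨t, -, ht⟩ := hJ.prod_mem_iff.1 hprod
  exact hψD t ht

/-- A nonzero form of degree at most four which is singular along an irreducible plane curve that
is not a line is the square of an irreducible quadratic form. -/
lemma exists_sq_eq_of_singular [IsAlgClosed K] (h2 : (2 : K) ≠ 0) (h3 : (3 : K) ≠ 0)
    {D : Set (Fin 3 → K)} (hne : D.Nonempty) (hD : ∀ P ∈ D, ∀ t : K, t ≠ 0 → t • P ∈ D)
    (hirr : ∀ (a b : MvPolynomial (Fin 3) K) (i j : ℕ), a.IsHomogeneous i → b.IsHomogeneous j →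
      (∀ v ∈ D, eval v a * eval v b = 0) → (∀ v ∈ D, eval v a = 0) ∨ (∀ v ∈ D, eval v b = 0))
    (hD0 : ∀ P ∈ D, P ≠ 0)
    (hspan : ∀ ψ : Fin 3 → K, (∀ P ∈ D, ∑ i, ψ i * P i = 0) → ψ = 0)
    {f : MvPolynomial (Fin 3) K} {d : ℕ} (hf : f.IsHomogeneous d) (hf0 : f ≠ 0) (hd : d ≤ 4)
    (hfD : ∀ P ∈ D, eval P f = 0) (hdf : ∀ P ∈ D, ∀ i, eval P (pderiv i f) = 0) :
    d = 4 ∧ ∃ p : MvPolynomial (Fin 3) K, Irreducible p ∧ p.IsHomogeneous 2 ∧ f = p ^ 2 ∧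
      ∀ (g : MvPolynomial (Fin 3) K) (e : ℕ), g.IsHomogeneous e → (∀ P ∈ D, eval P g = 0) →
        p ∣ g := by
  have : Infinite K := IsAlgClosed.instInfinite
  have hJ := isPrime_vanishingIdeal hne hD hirr
  have hmem : ∀ g : MvPolynomial (Fin 3) K, g ∈ vanishingIdeal K D ↔ ∀ P ∈ D, eval P g = 0 := by
    intro g
    simp [aeval_eq_eval]
  obtain ⟨p, e, hpe, hp, hpJ⟩ := exists_irreducible_isHomogeneous_mem
    (isHomogeneous_vanishingIdeal hD) (fun h0 => hf0 (by
      have := (hmem f).2 hfD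
      rwa [h0, Submodule.mem_bot] at this))
  have hpD := (hmem p).1 hpJ
  have key : ∀ (g : MvPolynomial (Fin 3) K) (e : ℕ), g.IsHomogeneous e →
      (∀ P ∈ D, eval P g = 0) → p ∣ g := fun g e' hg hgD =>
    dvd_of_forall_mem_eval_eq_zero hJ hD0 hspan hp hpe hpD hg hgD
  have he2 : 2 ≤ e := by
    by_contra! hlt
    interval_cases e
    · obtain ⟨c, rfl⟩ := eq_C_of_isHomogeneous_zero hpe
      obtain ⟨P, hP⟩ := hne
      have := hpD P hP
      rw [eval_C] at this
      exact hp.ne_zero (by rw [this, C_0])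
    · obtain ⟨φ, rfl⟩ := exists_eq_linPoly hpe
      have : φ = 0 := hspan φ fun P hP => by simpa using hpD P hP
      apply hp.ne_zero
      simp [this, linPoly]
  have hdeg : ∀ {a b : MvPolynomial (Fin 3) K} {i : ℕ}, a ∣ b → b ≠ 0 → a.IsHomogeneous e →
      b.IsHomogeneous i → e ≤ i := by
    intro a b i hab hb0 ha hb
    by_contra! hlt
    exact not_dvd_of_isHomogeneous_of_lt ha hb hb0 hlt hab
  obtain ⟨g, rfl⟩ := key f d hf hfD
  have hed := hdeg (dvd_mul_right p g) hf0 hpe hf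
  obtain ⟨k, rfl⟩ := Nat.exists_eq_add_of_le hed
  have hg := isHomogeneous_of_mul_left hp.ne_zero hpe hf
  have hgD : ∀ P ∈ D, eval P g = 0 := by
    by_contra hgD
    have hpd : ∀ i, pderiv i p = 0 := by
      intro i
      have h1 : (∀ P ∈ D, eval P g = 0) ∨ ∀ P ∈ D, eval P (pderiv i p) = 0 := by
        refine hirr g (pderiv i p) k (e - 1) hg hpe.pderiv fun P hP => ?_
        have := hdf P hP i
        simpa [Derivation.leibniz, hpD P hP] using this
      by_contra h0
      have := hdeg (key _ _ hpe.pderiv (h1.resolve_left hgD)) h0 hpe hpe.pderiv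
      omega
    have hE := hpe.sum_X_mul_pderiv
    simp only [hpd, mul_zero, Finset.sum_const_zero] at hE
    have hE' : C (e : K) * p = 0 := by
      rw [← smul_eq_C_mul, Nat.cast_smul_eq_nsmul]
      exact hE.symm
    have hK : (e : K) = 0 := C_eq_zero.1 ((mul_eq_zero.1 hE').resolve_right hp.ne_zero)
    have he4 : e ≤ 4 := by omega
    have h4 : (4 : K) ≠ 0 := by
      rw [show (4 : K) = 2 * 2 by norm_num]
      exact mul_ne_zero h2 h2
    interval_cases e
    · exact h2 (by exact_mod_cast hK)
    · exact h3 (by exact_mod_cast hK)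
    · exact h4 (by exact_mod_cast hK)
  obtain ⟨g', rfl⟩ := key g k hg hgD
  have hg0 : p * g' ≠ 0 := right_ne_zero_of_mul hf0
  have hek := hdeg (dvd_mul_right p g') hg0 hpe hg
  obtain rfl : e = 2 := by omega
  obtain rfl : k = 2 := by omega
  obtain ⟨c, rfl⟩ := eq_C_of_isHomogeneous_zero
    (isHomogeneous_of_mul_left (d := 0) hp.ne_zero hpe hg)
  have hc : c ≠ 0 := by rintro rfl; simp at hg0
  obtain ⟨a, ha⟩ := IsAlgClosed.exists_pow_nat_eq c (n := 2) (by norm_num)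
  have ha0 : a ≠ 0 := by rintro rfl; simp at ha; exact hc ha.symm
  have hu : IsUnit (C a : MvPolynomial (Fin 3) K) := (isUnit_iff_ne_zero.2 ha0).map C
  refine ⟨rfl, C a * p, ?_, ?_, ?_, ?_⟩
  · exact (irreducible_isUnit_mul hu).2 hp
  · simpa using (isHomogeneous_C _ a).mul hpe
  · rw [mul_pow, ← C_pow, ha]; ring
  · intro g e hg hgD
    exact hu.mul_left_dvd.2 (key g e hg hgD)

end PlaneCurve

section NormalForm

/-- The cone over the singular points of the surface `F = 0`. -/
def singCone (F : MvPolynomial (Fin 4) K) : Set (Fin 4 → K) :=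
  {v | v ≠ 0 ∧ eval v F = 0 ∧ ∀ u, eval v (dirDeriv u F) = 0}

/-- An irreducible surface of degree at most four covered by lines which have no common point,
whose singular locus is irreducible and spans the plane `φ = 0`. -/
structure IsRuledSingularAlong (φ : Fin 4 → K) (F : MvPolynomial (Fin 4) K) (d : ℕ) : Prop where
  two_ne_zero : (2 : K) ≠ 0
  three_ne_zero : (3 : K) ≠ 0
  irreducible : Irreducible F
  isHomogeneous : F.IsHomogeneous d
  le_four : d ≤ 4
  mem_plane : ∀ v ∈ singCone F, ∑ i, φ i * v i = 0
  nonempty : (singCone F).Nonempty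
  irred : ∀ (a b : MvPolynomial (Fin 4) K) (i j : ℕ), a.IsHomogeneous i → b.IsHomogeneous j →
    (∀ v ∈ singCone F, eval v a * eval v b = 0) →
      (∀ v ∈ singCone F, eval v a = 0) ∨ (∀ v ∈ singCone F, eval v b = 0)
  span : ∀ ψ : Fin 4 → K, (∀ v ∈ singCone F, ∑ i, ψ i * v i = 0) → ∃ c : K, ψ = c • φ
  exists_line : ∀ v, v ≠ 0 → eval v F = 0 → ∃ L, IsLineIn F L ∧ v ∈ L
  not_cone : ∀ v, v ≠ 0 → ∃ L, IsLineIn F L ∧ v ∉ L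

variable (K) in
/-- The embedding of the plane `x 0 = 0`. -/
def consZero : (Fin 3 → K) →ₗ[K] (Fin 4 → K) where
  toFun P := Fin.cons 0 P
  map_add' P Q := by
    funext i
    refine Fin.cases ?_ (fun j => ?_) i <;> simp
  map_smul' c P := by
    funext i
    refine Fin.cases ?_ (fun j => ?_) i <;> simp

variable (K) in
/-- The projection onto the plane `x 0 = 0`. -/
def tailMap : (Fin 4 → K) →ₗ[K] (Fin 3 → K) := LinearMap.funLeft K K Fin.succ

@[simp]
lemma consZero_apply (P : Fin 3 → K) : consZero K P = Fin.cons 0 P := rfl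

@[simp]
lemma tailMap_apply (v : Fin 4 → K) : tailMap K v = Fin.tail v := rfl

/-- A polynomial agrees with its restriction to the plane `x 0 = 0` modulo `X 0`. -/
lemma exists_eq_add_X_mul [IsAlgClosed K] (F : MvPolynomial (Fin 4) K) :
    ∃ G, F = linSubst (tailMap K) (linSubst (consZero K) F) + X 0 * G := by
  have : X 0 ∣ F - linSubst (tailMap K) (linSubst (consZero K) F) := by
    refine dvd_of_forall_eval_eq_zero X_prime.irreducible fun v hv => ?_
    rw [eval_X] at hv
    rw [map_sub, eval_linSubst, eval_linSubst, tailMap_apply, consZero_apply,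
      IsRuledQuartic.cons_tail hv, sub_self]
  obtain ⟨G, hG⟩ := this
  exact ⟨G, by rw [← hG]; ring⟩

lemma pderiv_eq_dirDeriv {n : ℕ} (i : Fin n) (F : MvPolynomial (Fin n) K) :
    pderiv i F = dirDeriv (Pi.single i 1) F := by
  rw [dirDeriv_eq_sum, Finset.sum_eq_single i] <;> simp +contextual

lemma isHomogeneous_of_X_mul {σ : Type*} {i : σ} {G : MvPolynomial σ K} {d : ℕ}
    (h : (X i * G).IsHomogeneous (d + 1)) : G.IsHomogeneous d :=
  isHomogeneous_of_mul_left (X_ne_zero i) (isHomogeneous_X K i) (by rwa [add_comm])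

/-- No ruled surface of degree at most four is singular exactly along an irreducible curve spanning
the plane `x 0 = 0`. -/
theorem IsRuledSingularAlong.elim_single [IsAlgClosed K] {F : MvPolynomial (Fin 4) K} {d : ℕ}
    (h : IsRuledSingularAlong (Pi.single 0 1) F d) : False := by
  have : Infinite K := IsAlgClosed.instInfinite
  have h2 := h.two_ne_zero
  have hplane : ∀ v ∈ singCone F, v 0 = 0 := fun v hv => by
    simpa [Pi.single_apply] using h.mem_plane v hv
  have hcons : ∀ v ∈ singCone F, (Fin.cons 0 (Fin.tail v) : Fin 4 → K) = v := fun v hv =>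
    IsRuledQuartic.cons_tail (hplane v hv)
  set D : Set (Fin 3 → K) := {P | (Fin.cons 0 P : Fin 4 → K) ∈ singCone F} with hDdef
  have htail : ∀ v ∈ singCone F, Fin.tail v ∈ D := fun v hv => by
    rwa [hDdef, Set.mem_ofPred_eq, hcons v hv]
  obtain ⟨F₁, hF₁⟩ := exists_eq_add_X_mul F
  obtain ⟨R, hR⟩ := exists_eq_add_X_mul F₁
  set f := linSubst (consZero K) F with hf
  set f₁ := linSubst (consZero K) F₁ with hf₁
  have hfd : f.IsHomogeneous d := isHomogeneous_linSubst _ h.isHomogeneous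
  -- the derivative of `F` transversal to the plane
  have hderiv : ∀ P ∈ D, eval (Fin.cons 0 P) F₁ = 0 := by
    intro P hP
    have h0 := hP.2.2 (Pi.single 0 1)
    have hz : tailMap K (Pi.single 0 1) = 0 := by
      funext i
      simp [Fin.tail]
    rw [hF₁, map_add, map_add, eval_dirDeriv_linSubst, eval_dirDeriv_mul, hz, dirDeriv_X,
      dirDeriv_eq_sum] at h0
    simpa using h0
  have hf0 : f ≠ 0 := by
    intro hf0
    rw [hf0, map_zero, zero_add] at hF₁
    rcases h.irreducible.isUnit_or_isUnit hF₁ with hu | hu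
    · exact X_prime.not_isUnit hu
    · obtain ⟨v, hv⟩ := h.nonempty
      refine (hu.map (eval v)).ne_zero ?_
      rw [← hcons v hv]
      exact hderiv _ (htail v hv)
  obtain ⟨rfl, p, hp, hp2, hfp, hdvd⟩ := exists_sq_eq_of_singular h2 h.three_ne_zero (D := D)
    (by obtain ⟨v, hv⟩ := h.nonempty; exact ⟨_, htail v hv⟩)
    (by
      rintro P ⟨hP, hPF, hPd⟩ t ht
      have hs : (Fin.cons 0 (t • P) : Fin 4 → K) = t • Fin.cons 0 P :=
        (consZero K).map_smul t P
      refine ⟨?_, ?_, fun u => ?_⟩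
      · rw [hs]; exact smul_ne_zero ht hP
      · rw [hs, eval_smul_of_isHomogeneous h.isHomogeneous, hPF, mul_zero]
      · rw [hs, eval_smul_of_isHomogeneous (isHomogeneous_dirDeriv u h.isHomogeneous), hPd,
          mul_zero])
    (by
      intro a b i j ha hb hab
      have := h.irred (linSubst (tailMap K) a) (linSubst (tailMap K) b) i j
        (isHomogeneous_linSubst _ ha) (isHomogeneous_linSubst _ hb) (fun v hv => by
          rw [eval_linSubst, eval_linSubst]
          exact hab _ (htail v hv))
      exact this.imp (fun h' P hP => by simpa using h' _ hP) (fun h' P hP => by simpa using h' _ hP))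
    (by
      rintro P ⟨hP, -⟩ rfl
      exact hP ((consZero K).map_zero))
    (by
      intro ψ hψ
      obtain ⟨c, hc⟩ := h.span (Fin.cons 0 ψ) (fun v hv => by
        have := hψ _ (htail v hv)
        rw [Fin.sum_univ_succ]
        simpa [Fin.tail] using this)
      funext i
      simpa using congrFun hc i.succ)
    hfd hf0 h.le_four
    (fun P hP => by rw [hf, eval_linSubst]; exact hP.2.1)
    (fun P hP i => by
      rw [pderiv_eq_dirDeriv, hf, eval_dirDeriv_linSubst]
      exact hP.2.2 _)
  have hF₁3 : F₁.IsHomogeneous 3 := by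
    refine isHomogeneous_of_X_mul (i := 0) ?_
    rw [show X 0 * F₁ = F - linSubst (tailMap K) f by rw [eq_sub_iff_add_eq, add_comm, ← hF₁]]
    exact h.isHomogeneous.sub (isHomogeneous_linSubst _ hfd)
  have hf₁3 : f₁.IsHomogeneous 3 := isHomogeneous_linSubst _ hF₁3
  obtain ⟨l, hl⟩ := hdvd f₁ 3 hf₁3 (fun P hP => by
    rw [hf₁, eval_linSubst]; exact hderiv P hP)
  have hl1 : l.IsHomogeneous 1 :=
    isHomogeneous_of_mul_left (e := 2) hp.ne_zero hp2 (by rw [← hl]; exact hf₁3)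
  have hR2 : R.IsHomogeneous 2 := by
    refine isHomogeneous_of_X_mul (i := 0) ?_
    rw [show X 0 * R = F₁ - linSubst (tailMap K) f₁ by rw [eq_sub_iff_add_eq, add_comm, ← hR]]
    exact hF₁3.sub (isHomogeneous_linSubst _ hf₁3)
  have hE1 := isHomogeneous_linSubst (tailMap K) hl1
  obtain ⟨b, hbs, hb⟩ := exists_bilinPoly_eq h2
    (q := linSubst (tailMap K) p + C 2⁻¹ * (X 0 * linSubst (tailMap K) l))
    ((isHomogeneous_linSubst _ hp2).add
      (by simpa using (isHomogeneous_C _ _).mul ((isHomogeneous_X K 0).mul hE1)))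
  obtain ⟨B, hBs, hB⟩ := exists_bilinPoly_eq h2
    (q := C 4⁻¹ * (linSubst (tailMap K) l * linSubst (tailMap K) l) - R)
    (IsHomogeneous.sub (by simpa using (isHomogeneous_C _ _).mul (hE1.mul hE1)) hR2)
  have hbv : ∀ v, b v v = eval (Fin.tail v) p + 2⁻¹ * (v 0 * eval (Fin.tail v) l) := by
    intro v
    have := eval_bilinPoly b id id v
    rw [← hb] at this
    simpa using this.symm
  have hBv : ∀ v, B v v = 4⁻¹ * (eval (Fin.tail v) l * eval (Fin.tail v) l) - eval v R := by
    intro v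
    have := eval_bilinPoly B id id v
    rw [← hB] at this
    simpa using this.symm
  have h4 : (4 : K) ≠ 0 := by
    rw [show (4 : K) = 2 * 2 by norm_num]
    exact mul_ne_zero h2 h2
  have hFv : ∀ v, eval v F = b v v ^ 2 - v 0 ^ 2 * B v v := by
    intro v
    have e1 : eval v F = eval (Fin.tail v) p ^ 2 +
        v 0 * (eval (Fin.tail v) p * eval (Fin.tail v) l + v 0 * eval v R) := by
      rw [hF₁, hfp]
      conv_lhs => rw [hR, hl]
      simp
    rw [e1, hbv, hBv]
    field_simp
    ring
  have hFeq : F = bilinPoly b id id * bilinPoly b id id -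
      X 0 * (X 0 * bilinPoly B id id) := by
    refine MvPolynomial.funext fun v => ?_
    rw [hFv]
    simp only [map_sub, map_mul, eval_X, eval_bilinPoly, id]
    ring
  refine IsRuledQuartic.elim (b := b) (B := B) (p := p) (F := F)
    ⟨h2, hbs, hBs, hp, hp2, fun P => ?_, h.irreducible, h.isHomogeneous, hFv, h.exists_line,
      h.not_cone, fun v hv hvF => ?_⟩
  · rw [hbv]
    simp
  · have hF0 : eval v F = 0 := by rw [hFv, hv, hvF]; ring
    have hns : v ∉ singCone F := fun hs => by
      have := hplane v hs
      rw [hv] at this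
      exact one_ne_zero this
    have hv0 : v ≠ 0 := by rintro rfl; simp at hv
    have : ∃ u, eval v (dirDeriv u F) ≠ 0 := by
      by_contra! hcon
      exact hns ⟨hv0, hF0, hcon⟩
    obtain ⟨u, hu⟩ := this
    refine ⟨u - u 0 • v, by simp [hv], fun hcon => hu ?_⟩
    rw [hFeq]
    simp only [map_sub, eval_dirDeriv_mul, eval_dirDeriv_bilinPoly, eval_bilinPoly, dirDeriv_X,
      eval_X, eval_C, id, hv, map_mul]
    simp only [map_sub, map_smul, smul_eq_mul] at hcon
    rw [hbs u v, hBs u v]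
    linear_combination 2 * hcon + 4 * u 0 * hvF

end NormalForm

section ChangeOfCoordinates

/-- Every nonzero linear form is a coordinate function in suitable coordinates. -/
lemma exists_linearEquiv_sum_mul_eq {φ : Fin 4 → K} (hφ : φ ≠ 0) :
    ∃ g : (Fin 4 → K) ≃ₗ[K] (Fin 4 → K), ∀ v, ∑ i, φ i * g v i = v 0 := by
  obtain ⟨k, hk⟩ := Function.ne_iff.1 hφ
  rw [Pi.zero_apply] at hk
  let M : (Fin 4 → K) →ₗ[K] (Fin 4 → K) := LinearMap.pi fun j =>
    if j = 0 then ∑ i, φ i • LinearMap.proj i else LinearMap.proj (Equiv.swap 0 k j)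
  have hM0 : ∀ v, M v 0 = ∑ i, φ i * v i := fun v => by simp [M]
  have hMj : ∀ v j, j ≠ 0 → M v j = v (Equiv.swap 0 k j) := fun v j hj => by simp [M, hj]
  have hinj : Function.Injective M := by
    refine (injective_iff_map_eq_zero M).2 fun v hv => ?_
    have hne : ∀ i, i ≠ k → v i = 0 := by
      intro i hi
      have hi0 : Equiv.swap 0 k i ≠ 0 := by
        intro h0
        apply hi
        rw [← Equiv.swap_apply_self 0 k i, h0, Equiv.swap_apply_left]
      have := hMj v _ hi0
      rw [hv, Equiv.swap_apply_self] at this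
      exact this.symm
    have h0 := hM0 v
    rw [hv, Finset.sum_eq_single k (fun i _ hi => by rw [hne i hi, mul_zero]) (by simp)] at h0
    funext i
    by_cases hi : i = k
    · subst hi
      exact (mul_eq_zero.1 h0.symm).resolve_left hk
    · exact hne i hi
  refine ⟨(LinearEquiv.ofInjectiveEndo M hinj).symm, fun v => ?_⟩
  rw [← hM0]
  exact congrFun ((LinearEquiv.ofInjectiveEndo M hinj).apply_symm_apply v) 0

/-- Linear changes of coordinates as algebra automorphisms. -/
noncomputable def linSubstEquiv [Infinite K] {n : ℕ} (g : (Fin n → K) ≃ₗ[K] (Fin n → K)) :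
    MvPolynomial (Fin n) K ≃ₐ[K] MvPolynomial (Fin n) K :=
  AlgEquiv.ofAlgHom (linSubst g.toLinearMap) (linSubst g.symm.toLinearMap)
    (AlgHom.ext fun F => MvPolynomial.funext fun v => by simp)
    (AlgHom.ext fun F => MvPolynomial.funext fun v => by simp)

lemma mem_singCone_linSubst (g : (Fin 4 → K) ≃ₗ[K] (Fin 4 → K)) {F : MvPolynomial (Fin 4) K}
    {v : Fin 4 → K} : v ∈ singCone (linSubst g.toLinearMap F) ↔ g v ∈ singCone F := by
  simp only [singCone, Set.mem_ofPred_eq, eval_linSubst, eval_dirDeriv_linSubst,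
    LinearEquiv.coe_coe, ne_eq, LinearEquiv.map_eq_zero_iff]
  refine and_congr_right fun _ => and_congr_right fun _ => ⟨fun h u => ?_, fun h u => h _⟩
  simpa using h (g.symm u)

lemma sum_mul_linearEquiv (g : (Fin 4 → K) ≃ₗ[K] (Fin 4 → K)) (ψ v : Fin 4 → K) :
    ∑ i, (∑ j, ψ j * g (Pi.single i 1) j) * v i = ∑ j, ψ j * g v j := by
  simp only [Finset.sum_mul]
  rw [Finset.sum_comm]
  refine Finset.sum_congr rfl fun i _ => ?_
  have := map_eq_sum_single g.toLinearMap v i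
  simp only [LinearEquiv.coe_coe] at this
  simp only [← this, Finset.mul_sum, mul_assoc]

lemma IsLineIn.linSubst {F : MvPolynomial (Fin 4) K} {L : Submodule K (Fin 4 → K)}
    (h : IsLineIn F L) (g : (Fin 4 → K) ≃ₗ[K] (Fin 4 → K)) :
    IsLineIn (linSubst g.toLinearMap F) (L.comap g.toLinearMap) where
  eval_eq_zero x hx := by
    rw [eval_linSubst]
    exact h.eval_eq_zero _ hx
  exists_mem ψ := by
    obtain ⟨P, hP, hP0, hψ⟩ := h.exists_mem fun i => ∑ j, ψ j * g.symm (Pi.single i 1) j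
    refine ⟨g.symm P, by simpa using hP, by simpa using hP0, ?_⟩
    rwa [sum_mul_linearEquiv] at hψ

/-- No ruled surface of degree at most four is singular exactly along an irreducible plane curve
which is not a line. -/
theorem IsRuledSingularAlong.elim [IsAlgClosed K] {φ : Fin 4 → K} {F : MvPolynomial (Fin 4) K}
    {d : ℕ} (hφ : φ ≠ 0) (h : IsRuledSingularAlong φ F d) : False := by
  have : Infinite K := IsAlgClosed.instInfinite
  obtain ⟨g, hg⟩ := exists_linearEquiv_sum_mul_eq hφ
  have hmem : ∀ v ∈ singCone F, g.symm v ∈ singCone (RQS.linSubst g.toLinearMap F) := fun v hv => by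
    rw [mem_singCone_linSubst]
    simpa using hv
  refine IsRuledSingularAlong.elim_single (F := RQS.linSubst g.toLinearMap F) (d := d)
    { two_ne_zero := h.two_ne_zero
      three_ne_zero := h.three_ne_zero
      irreducible := (MulEquiv.irreducible_iff (linSubstEquiv g)).2 h.irreducible
      isHomogeneous := isHomogeneous_linSubst _ h.isHomogeneous
      le_four := h.le_four
      mem_plane := ?_
      nonempty := ?_
      irred := ?_
      span := ?_
      exists_line := ?_
      not_cone := ?_ }
  · intro v hv
    have := h.mem_plane _ (mem_singCone_linSubst g |>.1 hv)
    rw [hg] at this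
    simpa [Pi.single_apply] using this
  · obtain ⟨v, hv⟩ := h.nonempty
    exact ⟨_, hmem v hv⟩
  · intro a b i j ha hb hab
    have := h.irred (RQS.linSubst g.symm.toLinearMap a) (RQS.linSubst g.symm.toLinearMap b) i j
      (isHomogeneous_linSubst _ ha) (isHomogeneous_linSubst _ hb) (fun v hv => by
        rw [eval_linSubst, eval_linSubst]
        exact hab _ (hmem v hv))
    exact this.imp
      (fun h' v hv => by simpa using h' _ (mem_singCone_linSubst g |>.1 hv))
      (fun h' v hv => by simpa using h' _ (mem_singCone_linSubst g |>.1 hv))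
  · intro ψ hψ
    obtain ⟨c, hc⟩ := h.span (fun i => ∑ j, ψ j * g.symm (Pi.single i 1) j) (fun v hv => by
      rw [sum_mul_linearEquiv]
      exact hψ _ (hmem v hv))
    refine ⟨c, funext fun k => ?_⟩
    have h1 := sum_mul_linearEquiv g.symm ψ (g (Pi.single k 1))
    rw [g.symm_apply_apply] at h1
    have h2 : ∑ i, (c • φ) i * g (Pi.single k 1) i = c * (Pi.single k 1 : Fin 4 → K) 0 := by
      rw [← hg (Pi.single k 1), Finset.mul_sum]
      exact Finset.sum_congr rfl fun i _ => by simp [mul_assoc]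
    rw [← hc, h1] at h2
    simpa [Pi.single_apply, eq_comm] using h2
  · intro v hv hvF
    rw [eval_linSubst] at hvF
    obtain ⟨L, hL, hvL⟩ := h.exists_line (g v) (by simpa using hv) hvF
    exact ⟨_, hL.linSubst g, hvL⟩
  · intro v hv
    obtain ⟨L, hL, hvL⟩ := h.not_cone (g v) (by simpa using hv)
    exact ⟨_, hL.linSubst g, hvL⟩

end ChangeOfCoordinates

section Degree

/-- The ideal generated by an irreducible polynomial over a factorial domain and its nonzero
derivative contains a nonzero constant. -/
lemma exists_mul_add_mul_derivative_eq_C {A : Type*} [CommRing A] [IsDomain A]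
    [UniqueFactorizationMonoid A] {Φ : Polynomial A} (hΦ : Irreducible Φ)
    (hd : Polynomial.derivative Φ ≠ 0) :
    ∃ (a b : Polynomial A) (h : A), h ≠ 0 ∧
      a * Φ + b * Polynomial.derivative Φ = Polynomial.C h := by
  classical
  let L := FractionRing A
  have hinj : Function.Injective (algebraMap A L) := IsFractionRing.injective A L
  have hdeg : Φ.natDegree ≠ 0 := fun h0 => hd (Polynomial.derivative_of_natDegree_zero h0)
  have hprim : Φ.IsPrimitive := hΦ.isPrimitive hdeg
  have hirr := (hprim.irreducible_iff_irreducible_map_fraction_map (K := L)).1 hΦ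
  have hsep := (Polynomial.separable_iff_derivative_ne_zero hirr).2 (by
    rw [Polynomial.derivative_map]
    exact (Polynomial.map_ne_zero_iff hinj).2 hd)
  obtain ⟨a, b, hab⟩ := hsep
  obtain ⟨r, hr, ha⟩ := IsLocalization.integerNormalization_spec (nonZeroDivisors A) a
  obtain ⟨s, hs, hb⟩ := IsLocalization.integerNormalization_spec (nonZeroDivisors A) b
  refine ⟨Polynomial.C s * IsLocalization.integerNormalization (nonZeroDivisors A) a,
    Polynomial.C r * IsLocalization.integerNormalization (nonZeroDivisors A) b, r * s,
    mul_ne_zero (nonZeroDivisors.ne_zero hr) (nonZeroDivisors.ne_zero hs), ?_⟩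
  apply Polynomial.map_injective _ hinj
  rw [Polynomial.derivative_map] at hab
  simp only [Polynomial.map_add, Polynomial.map_mul, ha, hb, Polynomial.map_C, Algebra.smul_def,
    Polynomial.algebraMap_apply, map_mul]
  linear_combination (Polynomial.C (algebraMap A L r) * Polynomial.C (algebraMap A L s)) * hab

lemma finSuccEquiv_pderiv_zero {n : ℕ} (F : MvPolynomial (Fin (n + 1)) K) :
    finSuccEquiv K n (pderiv 0 F) = Polynomial.derivative (finSuccEquiv K n F) := by
  induction F using MvPolynomial.induction_on with
  | C a => simp [finSuccEquiv_apply]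
  | add p q hp hq => simp [hp, hq]
  | mul_X p i hp =>
    rw [Derivation.leibniz, map_mul, Polynomial.derivative_mul, ← hp]
    refine Fin.cases ?_ (fun j => ?_) i
    · simp [finSuccEquiv_X_zero, mul_comm, add_comm]
    · simp [finSuccEquiv_X_succ, pderiv_X_of_ne (Fin.succ_ne_zero j), mul_comm]

/-- For a form which is nonzero at `(1, 0, …, 0)` and has a nonzero derivative in this direction,
some line through this point meets the hypersurface in `d` distinct points. -/
lemma exists_card_roots_of_single [IsAlgClosed K] {n d : ℕ}
    {F : MvPolynomial (Fin (n + 2)) K} (hF : Irreducible F) (hFd : F.IsHomogeneous d)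
    (h0 : eval (Pi.single 0 1) F ≠ 0) (hd : pderiv 0 F ≠ 0) :
    ∃ y : Fin (n + 1) → K, y ≠ 0 ∧ ∃ T : Finset K, T.card = d ∧
      ∀ s ∈ T, eval (Fin.cons s y : Fin (n + 2) → K) F = 0 := by
  classical
  have : Infinite K := IsAlgClosed.instInfinite
  set Φ := finSuccEquiv K (n + 1) F with hΦ
  obtain ⟨a, b, h, hh, hab⟩ := exists_mul_add_mul_derivative_eq_C
    (Φ := Φ) ((MulEquiv.irreducible_iff (finSuccEquiv K (n + 1))).2 hF) (by
      rw [hΦ, ← finSuccEquiv_pderiv_zero]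
      exact (EmbeddingLike.map_ne_zero_iff).2 hd)
  have heval : ∀ (s : K) (y : Fin (n + 1) → K),
      eval (Fin.cons s y : Fin (n + 2) → K) F = (Φ.map (eval y)).eval s :=
    fun s y => eval_eq_eval_mv_eval' y s F
  obtain ⟨y, hy⟩ : ∃ y, eval y (h * X 0) ≠ 0 := by
    by_contra! hcon
    exact mul_ne_zero hh (X_ne_zero 0) (MvPolynomial.funext fun y => by rw [hcon, map_zero])
  rw [map_mul, eval_X] at hy
  have hcoeff : ∀ y : Fin (n + 1) → K, (Φ.map (eval y)).coeff d = eval (Pi.single 0 1) F := by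
    obtain ⟨c, hc⟩ := eq_C_of_isHomogeneous_zero
      (hFd.finSuccEquiv_coeff_isHomogeneous d 0 (add_zero d))
    have hz : Φ.map (eval 0) = Polynomial.C (eval (Pi.single 0 1) F) * Polynomial.X ^ d := by
      refine Polynomial.funext fun s => ?_
      have : (Fin.cons s 0 : Fin (n + 2) → K) = s • Pi.single 0 1 := by
        funext i
        refine Fin.cases ?_ (fun j => ?_) i <;> simp
      rw [← heval, this, eval_smul_of_isHomogeneous hFd]
      rw [Polynomial.eval_mul, Polynomial.eval_C, Polynomial.eval_pow, Polynomial.eval_X, mul_comm]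
    intro y
    have h1 := congrArg (fun p => Polynomial.coeff p d) hz
    simp only [Polynomial.coeff_map, Polynomial.coeff_C_mul, Polynomial.coeff_X_pow_self,
      mul_one] at h1
    rw [hΦ, hc, eval_C] at h1
    rw [Polynomial.coeff_map, hΦ, hc, eval_C, h1]
  set P := Φ.map (eval y) with hP
  have hPd : d ≤ P.natDegree := Polynomial.le_natDegree_of_ne_zero (by rw [hcoeff]; exact h0)
  have hsep : P.Separable := by
    have h1 := congrArg (Polynomial.map (eval y)) hab
    simp only [Polynomial.map_add, Polynomial.map_mul, ← Polynomial.derivative_map,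
      Polynomial.map_C] at h1
    have hne : eval y h ≠ 0 := left_ne_zero_of_mul hy
    refine ⟨Polynomial.C (eval y h)⁻¹ * a.map (eval y), Polynomial.C (eval y h)⁻¹ * b.map (eval y),
      ?_⟩
    rw [mul_assoc, mul_assoc, ← mul_add, h1, ← Polynomial.C_mul, inv_mul_cancel₀ hne,
      Polynomial.C_1]
  have hcard : P.roots.toFinset.card = P.natDegree := by
    rw [Multiset.toFinset_card_of_nodup (Polynomial.nodup_roots hsep)]
    exact IsAlgClosed.card_roots_eq_natDegree
  obtain ⟨T, hT, hTd⟩ := Finset.exists_subset_card_eq (hPd.trans hcard.ge)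
  refine ⟨y, fun h => right_ne_zero_of_mul hy (by rw [h]; rfl), T, hTd, fun s hs => ?_⟩
  rw [heval]
  have := hT hs
  rw [Multiset.mem_toFinset] at this
  exact Polynomial.isRoot_of_mem_roots this

/-- Some line meets a hypersurface which is not everywhere singular in as many points as its
degree. -/
lemma exists_line_card_eq_degree [IsAlgClosed K] {n d : ℕ}
    {F : MvPolynomial (Fin (n + 2)) K} (hF : Irreducible F) (hFd : F.IsHomogeneous d)
    {i : Fin (n + 2)} (hi : pderiv i F ≠ 0) :
    ∃ u v : Fin (n + 2) → K, (∀ a c : K, a • u + c • v = 0 → a = 0 ∧ c = 0) ∧ eval v F ≠ 0 ∧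
      ∃ T : Finset K, T.card = d ∧ ∀ s ∈ T, eval (u + s • v) F = 0 := by
  have : Infinite K := IsAlgClosed.instInfinite
  have hex : ∀ G : MvPolynomial (Fin (n + 2)) K, G ≠ 0 → ∃ x, eval x G ≠ 0 := by
    intro G hG
    by_contra! hcon
    exact hG (MvPolynomial.funext fun y => by rw [hcon, map_zero])
  obtain ⟨x, hx⟩ := hex _ hi
  obtain ⟨v, hv⟩ := hex (X 0 * F * linPoly fun j => eval x (pderiv j F))
    (mul_ne_zero (mul_ne_zero (X_ne_zero 0) hF.ne_zero) (linPoly_ne_zero fun h0 =>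
      hx (congrFun h0 i)))
  rw [map_mul, map_mul, eval_X, eval_linPoly] at hv
  have hv0 : v 0 ≠ 0 := left_ne_zero_of_mul (left_ne_zero_of_mul hv)
  have hvF : eval v F ≠ 0 := right_ne_zero_of_mul (left_ne_zero_of_mul hv)
  let M : (Fin (n + 2) → K) →ₗ[K] (Fin (n + 2) → K) :=
    LinearMap.id + (LinearMap.proj 0).smulRight (v - Pi.single 0 1)
  have hM : ∀ w, M w = w + w 0 • (v - Pi.single 0 1) := fun w => rfl
  have hinj : Function.Injective M := by
    refine (injective_iff_map_eq_zero M).2 fun w hw => ?_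
    have h1 := congrFun (hM w) 0
    rw [hw] at h1
    have h2 : w 0 * v 0 = 0 := by
      simp at h1
      linear_combination -h1
    have h3 := hM w
    rw [hw, (mul_eq_zero.1 h2).resolve_right hv0] at h3
    simpa using h3.symm
  let g := LinearEquiv.ofInjectiveEndo M hinj
  have hg0 : g (Pi.single 0 1) = v := by
    change M _ = v
    rw [hM]
    simp
  obtain ⟨y, hy, T, hT, hroots⟩ := exists_card_roots_of_single
    (F := linSubst g.toLinearMap F) ((MulEquiv.irreducible_iff (linSubstEquiv g)).2 hF)
    (isHomogeneous_linSubst _ hFd) (by rw [eval_linSubst, LinearEquiv.coe_coe, hg0]; exact hvF)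
    (by
      intro h0
      apply right_ne_zero_of_mul hv
      have h1 := congrArg (eval (g.symm x)) h0
      rw [pderiv_eq_dirDeriv, eval_dirDeriv_linSubst, LinearEquiv.coe_coe, hg0,
        dirDeriv_eq_sum] at h1
      simpa [mul_comm] using h1)
  refine ⟨g (Fin.cons 0 y), v, fun a c hac => ?_, hvF, T, hT, fun s hs => ?_⟩
  · rw [← hg0, ← map_smul, ← map_smul, ← map_add, LinearEquiv.map_eq_zero_iff] at hac
    have hc : c = 0 := by simpa using congrFun hac 0
    obtain ⟨j, hj⟩ := Function.ne_iff.1 hy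
    have := congrFun hac j.succ
    simp at this hj
    exact ⟨this.resolve_right hj, hc⟩
  · have := hroots s hs
    rw [eval_linSubst] at this
    have hs : g (Fin.cons 0 y) + s • v = g (Fin.cons s y) := by
      rw [← hg0, ← map_smul, ← map_add]
      congr 1
      funext i
      refine Fin.cases ?_ (fun j => ?_) i <;> simp
    rw [hs]
    exact this

end Degree

section Equation

attribute [local instance] MvPolynomial.gradedAlgebra

/-- The representatives of the points of a subset of projective space. -/
def coneOver {n : ℕ} (X : Set (PP K n)) : Set (Fin n → K) :=
  {v | ∃ h : v ≠ 0, Projectivization.mk K v h ∈ X}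

lemma smul_mem_coneOver {n : ℕ} {X : Set (PP K n)} {v : Fin n → K} (hv : v ∈ coneOver X) {t : K}
    (ht : t ≠ 0) : t • v ∈ coneOver X := by
  obtain ⟨h, hX⟩ := hv
  refine ⟨smul_ne_zero ht h, ?_⟩
  rwa [(Projectivization.mk_eq_mk_iff' K (t • v) v (smul_ne_zero ht h) h).2 ⟨t, rfl⟩]

lemma coneOver_nonempty {n : ℕ} {X : Set (PP K n)} (hX : X.Nonempty) : (coneOver X).Nonempty := by
  obtain ⟨x, hx⟩ := hX
  induction x using Projectivization.ind with
  | h v hv => exact ⟨v, hv, hx⟩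

lemma vanishes_mk_iff {n d : ℕ} {p : MvPolynomial (Fin n) K} (hp : p.IsHomogeneous d)
    {v : Fin n → K} (hv : v ≠ 0) : vanishes p (Projectivization.mk K v hv) ↔ eval v p = 0 := by
  refine ⟨fun h => h v hv rfl, fun h w hw hwv => ?_⟩
  obtain ⟨a, rfl⟩ := (Projectivization.mk_eq_mk_iff' K w v hw hv).1 hwv
  rw [eval_smul_of_isHomogeneous hp, h, mul_zero]

lemma mem_vanishingIdeal_coneOver {n : ℕ} {X : Set (PP K n)} {p : MvPolynomial (Fin n) K} :
    p ∈ vanishingIdeal K (coneOver X) ↔ ∀ v ∈ coneOver X, eval v p = 0 := by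
  simp [aeval_eq_eval]

lemma zClosed_zeroLocus_singleton {n d : ℕ} {p : MvPolynomial (Fin n) K} (hp : p.IsHomogeneous d) :
    ZClosed (RQS.zeroLocus {p}) :=
  ⟨{p}, by rintro _ rfl; exact ⟨d, hp⟩, rfl⟩

lemma mem_of_forall_eval_eq_zero {n : ℕ} {X : Set (PP K n)} (hX : ZClosed X) {v : Fin n → K}
    (hv : v ≠ 0)
    (h : ∀ p ∈ vanishingIdeal K (coneOver X), ∀ d, p.IsHomogeneous d → eval v p = 0) :
    Projectivization.mk K v hv ∈ X := by
  obtain ⟨P, hP, rfl⟩ := hX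
  intro p hp
  obtain ⟨d, hpd⟩ := hP p hp
  rw [vanishes_mk_iff hpd]
  refine h p (mem_vanishingIdeal_coneOver.2 ?_) d hpd
  rintro w ⟨hw, hwX⟩
  exact hwX p hp w hw rfl

/-- Irreducibility in terms of homogeneous polynomials. -/
lemma ZIrred.forall_eval_eq_zero {n : ℕ} {X : Set (PP K n)} (hX : ZIrred X)
    (a b : MvPolynomial (Fin n) K) (i j : ℕ) (ha : a.IsHomogeneous i) (hb : b.IsHomogeneous j)
    (hab : ∀ v ∈ coneOver X, eval v a * eval v b = 0) :
    (∀ v ∈ coneOver X, eval v a = 0) ∨ (∀ v ∈ coneOver X, eval v b = 0) := by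
  have hmem : ∀ {d : ℕ} {p : MvPolynomial (Fin n) K}, p.IsHomogeneous d → ∀ {v} (hv : v ≠ 0),
      Projectivization.mk K v hv ∈ RQS.zeroLocus {p} ↔ eval v p = 0 := by
    intro d p hp v hv
    rw [← vanishes_mk_iff hp hv]
    exact ⟨fun h => h p rfl, by rintro h _ rfl; exact h⟩
  refine (hX.2 _ _ (zClosed_zeroLocus_singleton ha) (zClosed_zeroLocus_singleton hb) ?_).imp ?_ ?_
  · intro x hx
    induction x using Projectivization.ind with
    | h v hv => exact (mul_eq_zero.1 (hab v ⟨hv, hx⟩)).imp (hmem ha hv).2 (hmem hb hv).2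
  · rintro h v ⟨hv, hvX⟩
    exact (hmem ha hv).1 (h hvX)
  · rintro h v ⟨hv, hvX⟩
    exact (hmem hb hv).1 (h hvX)

lemma ZIrred.isPrime_vanishingIdeal [Infinite K] {n : ℕ} {X : Set (PP K n)} (hX : ZIrred X) :
    (vanishingIdeal K (coneOver X)).IsPrime :=
  RQS.isPrime_vanishingIdeal (coneOver_nonempty hX.1) (fun _ hv _ ht => smul_mem_coneOver hv ht)
    hX.forall_eval_eq_zero

lemma vanishingIdeal_coneOver_mono {n : ℕ} {X Y : Set (PP K n)} (h : X ⊆ Y) :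
    vanishingIdeal K (coneOver Y) ≤ vanishingIdeal K (coneOver X) := by
  intro p hp
  rw [mem_vanishingIdeal_coneOver] at hp ⊢
  rintro v ⟨hv, hvX⟩
  exact hp v ⟨hv, h hvX⟩

lemma vanishingIdeal_coneOver_lt {n : ℕ} {X Y : Set (PP K n)} (hX : ZClosed X) (h : X ⊂ Y) :
    vanishingIdeal K (coneOver Y) < vanishingIdeal K (coneOver X) := by
  refine lt_of_le_of_ne (vanishingIdeal_coneOver_mono h.subset) fun heq => h.not_subset ?_
  intro x hx
  induction x using Projectivization.ind with
  | h v hv =>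
    refine mem_of_forall_eval_eq_zero hX hv fun p hp d _ => ?_
    rw [← heq] at hp
    exact mem_vanishingIdeal_coneOver.1 hp v ⟨hv, hx⟩

lemma vanishingIdeal_coneOver_lt_singleton_zero [Infinite K] {n : ℕ} {X : Set (PP K n)}
    (hX : X.Nonempty) :
    vanishingIdeal K (coneOver X) < vanishingIdeal K {(0 : Fin n → K)} := by
  obtain ⟨v, hv⟩ := coneOver_nonempty hX
  refine lt_of_le_of_ne (fun p hp => ?_) fun heq => ?_
  · have h0 := isHomogeneous_vanishingIdeal
      (fun _ hv _ ht => smul_mem_coneOver (X := X) hv ht) 0 hp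
    rw [decompose_eq_homogeneousComponent, mem_vanishingIdeal_coneOver] at h0
    have := h0 v hv
    rw [homogeneousComponent_zero, eval_C] at this
    simpa [aeval_eq_eval, ← constantCoeff_eq] using this
  · obtain ⟨j, hj⟩ := Function.ne_iff.1 hv.1
    have hmem : MvPolynomial.X j ∈ vanishingIdeal K {(0 : Fin n → K)} := by simp
    rw [← heq, mem_vanishingIdeal_coneOver] at hmem
    exact hj (by simpa using hmem v hv)

/-- An irreducible closed surface in `ℙ³` is the zero set of an irreducible form generating its
homogeneous ideal. -/
lemma exists_equation [IsAlgClosed K] {S : Set (PP K 4)} (hc : ZClosed S) (hi : ZIrred S)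
    (hd : dimGE S 2) (hne : ∃ x, x ∉ S) :
    ∃ (F : MvPolynomial (Fin 4) K) (d : ℕ), F.IsHomogeneous d ∧ Irreducible F ∧
      (∀ v, v ∈ coneOver S ↔ v ≠ 0 ∧ eval v F = 0) ∧
      ∀ g, (∀ v ∈ coneOver S, eval v g = 0) → F ∣ g := by
  have : Infinite K := IsAlgClosed.instInfinite
  have hJ := hi.isPrime_vanishingIdeal
  obtain ⟨F, d, hFd, hF, hFJ⟩ := exists_irreducible_isHomogeneous_mem
    (isHomogeneous_vanishingIdeal (fun _ hv _ ht => smul_mem_coneOver (X := S) hv ht)) (by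
      intro hbot
      obtain ⟨x, hx⟩ := hne
      induction x using Projectivization.ind with
      | h v hv =>
        refine hx (mem_of_forall_eval_eq_zero hc hv fun p hp d _ => ?_)
        rw [hbot, Submodule.mem_bot] at hp
        rw [hp, map_zero])
  obtain ⟨f, hf, hmono⟩ := hd
  have hFp : (Ideal.span {F}).IsPrime := (Ideal.span_singleton_prime hF.ne_zero).2 hF.prime
  have hle : Ideal.span {F} ≤ vanishingIdeal K (coneOver S) :=
    (Ideal.span_singleton_le_iff_mem _).2 hFJ
  have hle2 : vanishingIdeal K (coneOver S) ≤ vanishingIdeal K (coneOver (f 2)) :=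
    vanishingIdeal_coneOver_mono (hf 2).2.2
  have hprime := fun i => (hf i).2.1.isPrime_vanishingIdeal
  have hmax : (vanishingIdeal K {(0 : Fin 4 → K)}).IsPrime :=
    (isMaximal_vanishingIdeal_singleton _).isPrime
  have heq : Ideal.span {F} = vanishingIdeal K (coneOver (f 2)) := by
    by_contra hne'
    apply not_strictMono_primeSpectrum (n := 4) (K := K)
      ![⟨⊥, Ideal.isPrime_bot⟩, ⟨_, hFp⟩, ⟨_, hprime 2⟩, ⟨_, hprime 1⟩, ⟨_, hprime 0⟩, ⟨_, hmax⟩]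
    rw [Fin.strictMono_iff_lt_succ]
    intro i
    fin_cases i
    · change (⊥ : Ideal (MvPolynomial (Fin 4) K)) < Ideal.span {F}
      rw [bot_lt_iff_ne_bot, Ne, Ideal.span_singleton_eq_bot]
      exact hF.ne_zero
    · exact lt_of_le_of_ne (α := Ideal (MvPolynomial (Fin 4) K)) (hle.trans hle2) hne'
    · exact vanishingIdeal_coneOver_lt (hf 1).1 (hmono (by decide : (1 : Fin 3) < 2))
    · exact vanishingIdeal_coneOver_lt (hf 0).1 (hmono (by decide : (0 : Fin 3) < 1))
    · exact vanishingIdeal_coneOver_lt_singleton_zero (hf 0).2.1.1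
  have hdvd : ∀ g, (∀ v ∈ coneOver S, eval v g = 0) → F ∣ g := by
    intro g hg
    rw [← Ideal.mem_span_singleton, heq]
    exact hle2 (mem_vanishingIdeal_coneOver.2 hg)
  refine ⟨F, d, hFd, hF, fun v => ⟨fun hv => ⟨hv.1, mem_vanishingIdeal_coneOver.1 hFJ v hv⟩, ?_⟩,
    hdvd⟩
  rintro ⟨hv, hvF⟩
  refine ⟨hv, mem_of_forall_eval_eq_zero hc hv fun p hp d _ => ?_⟩
  obtain ⟨q, rfl⟩ := hdvd p (mem_vanishingIdeal_coneOver.1 hp)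
  rw [map_mul, hvF, zero_mul]

/-- The Jacobian criterion for a surface in terms of its equation. -/
lemma coneOver_singLocus {S : Set (PP K 4)} {F : MvPolynomial (Fin 4) K} {d : ℕ}
    (hFd : F.IsHomogeneous d) (hS : ∀ v, v ∈ coneOver S ↔ v ≠ 0 ∧ eval v F = 0)
    (hdvd : ∀ g, (∀ v ∈ coneOver S, eval v g = 0) → F ∣ g) :
    coneOver (singLocus S) = singCone F := by
  have hgrad : ∀ v, eval v F = 0 →
      gradSpan S v = Submodule.span K {fun i => eval v (pderiv i F)} := by
    intro v hv
    refine le_antisymm (Submodule.span_le.2 ?_) (Submodule.span_mono ?_)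
    · rintro _ ⟨p, ⟨-, hp⟩, rfl⟩
      obtain ⟨q, rfl⟩ := hdvd p fun w hw => hp _ hw.2 w hw.1 rfl
      refine Submodule.mem_span_singleton.2 ⟨eval v q, funext fun i => ?_⟩
      simp [Derivation.leibniz, hv]
    · rintro _ rfl
      refine ⟨F, ⟨⟨d, hFd⟩, fun x hx => ?_⟩, rfl⟩
      induction x using Projectivization.ind with
      | h w hw =>
        rw [vanishes_mk_iff hFd]
        exact ((hS w).1 ⟨hw, hx⟩).2
  have hfin : ∀ v, eval v F = 0 →
      (Module.finrank K (gradSpan S v) = 1 ↔ ¬ ∀ u, eval v (dirDeriv u F) = 0) := by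
    intro v hv
    rw [hgrad v hv]
    by_cases h0 : (fun i => eval v (pderiv i F)) = 0
    · have : ∀ u, eval v (dirDeriv u F) = 0 := fun u => by
        rw [dirDeriv_eq_sum, map_sum]
        refine Finset.sum_eq_zero fun i _ => ?_
        rw [map_mul, show eval v (pderiv i F) = 0 from congrFun h0 i, mul_zero]
      rw [h0, Submodule.span_singleton_eq_bot.2 rfl]
      simp [this]
    · rw [finrank_span_singleton h0]
      simp only [true_iff]
      intro hall
      refine h0 (funext fun i => ?_)
      rw [pderiv_eq_dirDeriv]
      exact hall _
  ext v
  constructor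
  · rintro ⟨hv, hvS, hns⟩
    have hvF := ((hS v).1 ⟨hv, hvS⟩).2
    refine ⟨hv, hvF, ?_⟩
    by_contra hcon
    refine hns fun w hw hwv => (hfin w ?_).2 fun hall => hcon ?_
    · obtain ⟨a, rfl⟩ := (Projectivization.mk_eq_mk_iff' K w v hw hv).1 hwv
      rw [eval_smul_of_isHomogeneous hFd, hvF, mul_zero]
    · obtain ⟨a, rfl⟩ := (Projectivization.mk_eq_mk_iff' K w v hw hv).1 hwv
      have ha : a ≠ 0 := by rintro rfl; simp at hw
      intro u
      have := hall u
      rw [eval_smul_of_isHomogeneous (isHomogeneous_dirDeriv u hFd)] at this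
      exact (mul_eq_zero.1 this).resolve_left (pow_ne_zero _ ha)
  · rintro ⟨hv, hvF, hall⟩
    have hvS := ((hS v).2 ⟨hv, hvF⟩).2
    exact ⟨hv, hvS, fun hsm => (hfin v hvF).1 (hsm v hv rfl) hall⟩

end Equation

section Lines

lemma wedgePt_smul_left (a : K) (w : Fin 6 → K) (v : Fin 4 → K) :
    wedgePt (a • w) v = a • wedgePt w v := by
  funext i
  fin_cases i <;> simp [wedgePt] <;> ring

/-- The vectors representing the points of the line with Plücker vector `w`. -/
def lineSub (w : Fin 6 → K) : Submodule K (Fin 4 → K) where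
  carrier := {v | wedgePt w v = 0}
  add_mem' := by
    intro u v hu hv
    have : wedgePt w (u + v) = wedgePt w u + wedgePt w v := by
      funext i
      fin_cases i <;> simp [wedgePt] <;> ring
    rw [Set.mem_ofPred_eq, this, hu, hv, add_zero]
  zero_mem' := by
    funext i
    fin_cases i <;> simp [wedgePt]
  smul_mem' := by
    intro a v hv
    have : wedgePt w (a • v) = a • wedgePt w v := by
      funext i
      fin_cases i <;> simp [wedgePt] <;> ring
    rw [Set.mem_ofPred_eq, this, hv, smul_zero]

lemma mk_mem_lineOfRep_iff {w : Fin 6 → K} {v : Fin 4 → K} (hv : v ≠ 0) :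
    Projectivization.mk K v hv ∈ lineOfRep w ↔ v ∈ lineSub w := by
  refine ⟨fun h => h v hv rfl, fun h u hu huv => ?_⟩
  obtain ⟨a, rfl⟩ := (Projectivization.mk_eq_mk_iff' K u v hu hv).1 huv
  exact (lineSub w).smul_mem a h

lemma mk_mem_lineOf_mk_iff {w : Fin 6 → K} (hw : w ≠ 0) {v : Fin 4 → K} (hv : v ≠ 0) :
    Projectivization.mk K v hv ∈ lineOf (Projectivization.mk K w hw) ↔ v ∈ lineSub w := by
  refine ⟨fun h => h w hw rfl v hv rfl, fun h z hz hzw => ?_⟩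
  rw [mk_mem_lineOfRep_iff]
  obtain ⟨a, rfl⟩ := (Projectivization.mk_eq_mk_iff' K z w hz hw).1 hzw
  change wedgePt (a • w) v = 0
  rw [wedgePt_smul_left, show wedgePt w v = 0 from h, smul_zero]

/-- The point of intersection of the line with Plücker vector `w` and the plane `ψ`. -/
def meetPlane (w : Fin 6 → K) (ψ : Fin 4 → K) : Fin 4 → K :=
  ![-(ψ 1 * w 0) - ψ 2 * w 1 - ψ 3 * w 2, ψ 0 * w 0 - ψ 2 * w 3 - ψ 3 * w 4,
    ψ 0 * w 1 + ψ 1 * w 3 - ψ 3 * w 5, ψ 0 * w 2 + ψ 1 * w 4 + ψ 2 * w 5]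

lemma meetPlane_mem {w : Fin 6 → K} (hw : plQuad w = 0) (ψ : Fin 4 → K) :
    meetPlane w ψ ∈ lineSub w := by
  change wedgePt w _ = 0
  rw [plQuad] at hw
  funext i
  fin_cases i <;> simp [wedgePt, meetPlane]
  · linear_combination -ψ 3 * hw
  · linear_combination ψ 2 * hw
  · linear_combination -ψ 1 * hw
  · linear_combination ψ 0 * hw

lemma sum_mul_meetPlane (w : Fin 6 → K) (φ ψ : Fin 4 → K) :
    ∑ i, φ i * meetPlane w ψ i = -∑ i, ψ i * meetPlane w φ i := by
  simp only [meetPlane, Fin.sum_univ_four, Matrix.cons_val]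
  ring

/-- A line meets every plane. -/
lemma exists_mem_lineSub {w : Fin 6 → K} (hw0 : w ≠ 0) (hw : plQuad w = 0) (ψ : Fin 4 → K) :
    ∃ P ∈ lineSub w, P ≠ 0 ∧ ∑ i, ψ i * P i = 0 := by
  by_cases h0 : meetPlane w ψ = 0
  · by_contra! hcon
    have hz : ∀ φ, meetPlane w φ = 0 := fun φ => by
      by_contra hφ
      refine hcon _ (meetPlane_mem hw φ) hφ ?_
      rw [sum_mul_meetPlane, h0]
      simp
    apply hw0
    have e0 := hz (Pi.single 0 1)
    have e1 := hz (Pi.single 1 1)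
    have e2 := hz (Pi.single 2 1)
    funext i
    fin_cases i
    · simpa [meetPlane] using congrFun e0 1
    · simpa [meetPlane] using congrFun e0 2
    · simpa [meetPlane] using congrFun e0 3
    · simpa [meetPlane] using congrFun e1 2
    · simpa [meetPlane] using congrFun e1 3
    · simpa [meetPlane] using congrFun e2 3
  · refine ⟨_, meetPlane_mem hw ψ, h0, ?_⟩
    simp only [meetPlane, Fin.sum_univ_four, Matrix.cons_val]
    ring

lemma plucker_ne_zero {u v : Fin 4 → K} (huv : ∀ a c : K, a • u + c • v = 0 → a = 0 ∧ c = 0) :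
    plucker u v ≠ 0 := by
  intro h0
  have hm : ∀ i j, v j * u i = u j * v i := by
    have e0 : u 0 * v 1 - u 1 * v 0 = 0 := congrFun h0 0
    have e1 : u 0 * v 2 - u 2 * v 0 = 0 := congrFun h0 1
    have e2 : u 0 * v 3 - u 3 * v 0 = 0 := congrFun h0 2
    have e3 : u 1 * v 2 - u 2 * v 1 = 0 := congrFun h0 3
    have e4 : u 1 * v 3 - u 3 * v 1 = 0 := congrFun h0 4
    have e5 : u 2 * v 3 - u 3 * v 2 = 0 := congrFun h0 5
    intro i j
    fin_cases i <;> fin_cases j <;> simp only [Fin.isValue, Fin.mk_zero, Fin.mk_one,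
      Fin.reduceFinMk] <;> grind
  have hu : u = 0 := funext fun j => by
    refine neg_eq_zero.1 (huv (v j) (-u j) (funext fun i => ?_)).2
    simp [hm i j]
  exact one_ne_zero (huv 1 0 (by simp [hu])).1

lemma plQuad_plucker (u v : Fin 4 → K) : plQuad (plucker u v) = 0 := by
  simp only [plQuad, plucker, Matrix.cons_val]
  ring

lemma smul_add_smul_mem_lineSub_plucker (u v : Fin 4 → K) (a c : K) :
    a • u + c • v ∈ lineSub (plucker u v) := by
  change wedgePt _ _ = 0
  funext i
  fin_cases i <;> simp [wedgePt, plucker] <;> ring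

/-- The degree of the equation of a surface is at most the degree of the surface. -/
lemma degree_le_of_hasSurfDeg [IsAlgClosed K] {S : Set (PP K 4)} {m : ℕ} (hdeg : HasSurfDeg S m)
    {F : MvPolynomial (Fin 4) K} {d : ℕ} (hF : Irreducible F) (hFd : F.IsHomogeneous d)
    (hS : ∀ v, v ∈ coneOver S ↔ v ≠ 0 ∧ eval v F = 0) {i : Fin 4} (hi : pderiv i F ≠ 0) :
    d ≤ m := by
  obtain ⟨u, v, huv, hvF, T, hT, hroots⟩ := exists_line_card_eq_degree hF hFd hi
  have hv : v ≠ 0 := by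
    rintro rfl
    exact one_ne_zero (huv 0 1 (by simp)).2
  have hne : ∀ s : K, u + s • v ≠ 0 := fun s h0 =>
    one_ne_zero (huv 1 s (by rw [one_smul, h0])).1
  have hmem : ∀ s : K, u + s • v ∈ lineSub (plucker u v) := fun s => by
    simpa using smul_add_smul_mem_lineSub_plucker u v 1 s
  obtain ⟨hfin, hcard⟩ := hdeg.1 (plucker u v) ⟨plucker_ne_zero huv, plQuad_plucker u v⟩
    fun hsub => by
      have hvl : v ∈ lineSub (plucker u v) := by
        simpa using smul_add_smul_mem_lineSub_plucker u v 0 1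
      exact hvF ((hS v).1 ⟨hv, hsub ((mk_mem_lineOfRep_iff hv).2 hvl)⟩).2
  let pt : K → PP K 4 := fun s => Projectivization.mk K (u + s • v) (hne s)
  have hinj : Function.Injective pt := by
    intro s t hst
    obtain ⟨a, ha⟩ := (Projectivization.mk_eq_mk_iff' K _ _ (hne s) (hne t)).1 hst
    obtain ⟨h1, h2⟩ := huv (a - 1) (a * t - s) (by
      rw [← sub_eq_zero] at ha
      rw [← ha]
      module)
    rw [sub_eq_zero.1 h1, one_mul, sub_eq_zero] at h2
    exact h2.symm
  calc d = (pt '' T).ncard := by rw [Set.ncard_image_of_injective _ hinj, Set.ncard_coe_finset, hT]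
    _ ≤ (S ∩ lineOfRep (plucker u v)).ncard := by
      refine Set.ncard_le_ncard ?_ hfin
      rintro _ ⟨s, hs, rfl⟩
      exact ⟨((hS _).2 ⟨hne s, hroots s hs⟩).2, (mk_mem_lineOfRep_iff (hne s)).2 (hmem s)⟩
    _ ≤ m := hcard

/-- A curve of degree two spans at least a plane. -/
lemma exists_eq_smul_of_hasCurveDeg_two {D : Set (PP K 4)} (hD : HasCurveDeg D 2) {φ ψ : Fin 4 → K}
    (hφ0 : φ ≠ 0) (hφ : ∀ v ∈ coneOver D, ∑ i, φ i * v i = 0)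
    (hψ : ∀ v ∈ coneOver D, ∑ i, ψ i * v i = 0) : ∃ c : K, ψ = c • φ := by
  obtain ⟨χ, -, hχD, hcard⟩ := hD.2
  obtain ⟨x, y, hxy, hset⟩ := Set.ncard_eq_two.1 hcard
  have hx : x ∈ D ∩ hyp χ := by rw [hset]; simp
  have hy : y ∈ D ∩ hyp χ := by rw [hset]; simp
  obtain ⟨z, hzD, hzχ⟩ := Set.not_subset.1 hχD
  induction x using Projectivization.ind with | h a ha => ?_
  induction y using Projectivization.ind with | h b hb => ?_
  induction z using Projectivization.ind with | h c hc => ?_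
  have hχa : ∑ i, χ i * a i = 0 := hx.2 a ha rfl
  have hχb : ∑ i, χ i * b i = 0 := hy.2 b hb rfl
  have hχc : ∑ i, χ i * c i ≠ 0 := by
    intro h0
    refine hzχ fun v hv hvc => ?_
    obtain ⟨t, rfl⟩ := (Projectivization.mk_eq_mk_iff' K v c hv hc).1 hvc
    rw [← mul_zero t, ← h0, Finset.mul_sum]
    exact Finset.sum_congr rfl fun i _ => by simp only [Pi.smul_apply, smul_eq_mul]; ring
  have hli : LinearIndependent K ![a, b, c] := by
    rw [Fintype.linearIndependent_iff]
    intro g hg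
    simp only [Fin.sum_univ_three, Matrix.cons_val] at hg
    have hg2 : g 2 = 0 := by
      have h1 : ∑ i, χ i * (g 0 • a + g 1 • b + g 2 • c) i = 0 := by rw [hg]; simp
      have h2 : ∑ i, χ i * (g 0 • a + g 1 • b + g 2 • c) i = g 0 * ∑ i, χ i * a i +
          g 1 * ∑ i, χ i * b i + g 2 * ∑ i, χ i * c i := by
        simp only [Finset.mul_sum, ← Finset.sum_add_distrib]
        exact Finset.sum_congr rfl fun i _ => by
          simp only [Pi.add_apply, Pi.smul_apply, smul_eq_mul]; ring
      rw [h2, hχa, hχb, mul_zero, mul_zero, zero_add, zero_add] at h1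
      exact (mul_eq_zero.1 h1).resolve_right hχc
    rw [hg2, zero_smul, add_zero] at hg
    have hg0 : g 0 = 0 := by
      by_contra h0
      refine hxy ((Projectivization.mk_eq_mk_iff' K a b ha hb).2 ⟨-(g 0)⁻¹ * g 1, ?_⟩)
      rw [mul_smul, neg_smul, ← smul_neg, ← eq_neg_of_add_eq_zero_left hg, inv_smul_smul₀ h0]
    rw [hg0, zero_smul, zero_add] at hg
    have hg1 : g 1 = 0 := (smul_eq_zero.1 hg).resolve_right hb
    intro i
    fin_cases i
    exacts [hg0, hg1, hg2]
  let M : Matrix (Fin 3) (Fin 4) K := Matrix.of ![a, b, c]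
  have hrank : M.rank = 3 := by simpa using LinearIndependent.rank_matrix (M := M) hli
  have hker : Module.finrank K (LinearMap.ker M.mulVecLin) = 1 := by
    have h1 := M.mulVecLin.finrank_range_add_finrank_ker
    rw [← Matrix.rank, hrank] at h1
    simp at h1
    omega
  have hmem : ∀ θ : Fin 4 → K, (∀ v ∈ coneOver D, ∑ i, θ i * v i = 0) →
      θ ∈ LinearMap.ker M.mulVecLin := by
    intro θ hθ
    have e : ∀ v ∈ coneOver D, ∑ i, v i * θ i = 0 := fun v hv => by
      rw [← hθ v hv]
      exact Finset.sum_congr rfl fun i _ => mul_comm _ _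
    rw [LinearMap.mem_ker, Matrix.mulVecLin_apply]
    funext k
    fin_cases k
    exacts [e a ⟨ha, hx.1⟩, e b ⟨hb, hy.1⟩, e c ⟨hc, hzD⟩]
  obtain ⟨t, ht⟩ := (finrank_eq_one_iff_of_nonzero' (⟨φ, hmem φ hφ⟩ : LinearMap.ker M.mulVecLin)
    (fun h0 => hφ0 (congrArg Subtype.val h0))).1 hker ⟨ψ, hmem ψ hψ⟩
  exact ⟨t, (congrArg Subtype.val ht).symm⟩

lemma natCast_ne_zero_of_lt {m : ℕ} (hm : 0 < m) (h : ringChar K = 0 ∨ m < ringChar K) :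
    (m : K) ≠ 0 := by
  intro h0
  have hdvd := ringChar.dvd h0
  rcases h with h | h
  · rw [h, zero_dvd_iff] at hdvd
    omega
  · exact absurd (Nat.le_of_dvd hm hdvd) (by omega)

end Lines

theorem statement_13 (K : Type) [Field K] [IsAlgClosed K]
    (hchar : ringChar K = 0 ∨ 3 < ringChar K)
    (S : Set (PP K 4)) (hruled : IsRuled S) (hdeg : HasSurfDeg S 4)
    (hcone : ¬ IsCone S) :
    ¬ IsConic (singLocus S) := by
  rintro ⟨-, hirr, -, hcurve, φ, hφ0, hφ⟩
  obtain ⟨hclosed, hSirr, ⟨hdim, -⟩, hlines⟩ := hruled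
  obtain ⟨F, d, hFd, hF, hS, hdvd⟩ := exists_equation hclosed hSirr hdim (by
    obtain ⟨w, -, hw, -⟩ := hdeg.2
    obtain ⟨x, -, hx⟩ := Set.not_subset.1 hw
    exact ⟨x, hx⟩)
  have hsing := coneOver_singLocus hFd hS hdvd
  have hplane : ∀ v ∈ singCone F, ∑ i, φ i * v i = 0 := by
    intro v hv
    rw [← hsing] at hv
    exact hφ hv.2 v hv.1 rfl
  obtain ⟨v₀, hv₀⟩ := coneOver_nonempty hSirr.1
  have hv₀F := ((hS v₀).1 hv₀).2
  have hgrad : ∃ i, pderiv i F ≠ 0 := by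
    by_contra! hcon
    have hd1 : d ≤ 1 := by
      by_contra! hlt
      refine not_dvd_of_isHomogeneous_of_lt hFd (isHomogeneous_linPoly φ) (linPoly_ne_zero hφ0) hlt
        (hdvd _ fun v hv => ?_)
      rw [eval_linPoly]
      exact hplane v ⟨hv.1, ((hS v).1 hv).2, fun u => by simp [dirDeriv_eq_sum, hcon]⟩
    interval_cases d
    · obtain ⟨c, rfl⟩ := eq_C_of_isHomogeneous_zero hFd
      rw [eval_C] at hv₀F
      exact hF.ne_zero (by rw [hv₀F, C_0])
    · refine hF.ne_zero ?_
      rw [← one_smul ℕ F, ← hFd.sum_X_mul_pderiv]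
      simp [hcon]
  obtain ⟨i, hi⟩ := hgrad
  have hline : ∀ (w : Fin 6 → K) (hw : w ≠ 0), plQuad w = 0 →
      lineOf (Projectivization.mk K w hw) ⊆ S → IsLineIn F (lineSub w) := by
    intro w hw hq hwS
    refine ⟨fun x hx => ?_, exists_mem_lineSub hw hq⟩
    by_cases hx0 : x = 0
    · rw [hx0, ← zero_smul K v₀, eval_smul_of_isHomogeneous hFd, hv₀F, mul_zero]
    · exact ((hS x).1 ⟨hx0, hwS ((mk_mem_lineOf_mk_iff hw hx0).2 hx)⟩).2
  refine IsRuledSingularAlong.elim (F := F) (d := d) hφ0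
    { two_ne_zero := by exact_mod_cast natCast_ne_zero_of_lt (m := 2) (by norm_num) (by omega)
      three_ne_zero := by exact_mod_cast natCast_ne_zero_of_lt (m := 3) (by norm_num) hchar
      irreducible := hF
      isHomogeneous := hFd
      le_four := degree_le_of_hasSurfDeg hdeg hF hFd hS hi
      mem_plane := hplane
      nonempty := hsing ▸ coneOver_nonempty hirr.1
      irred := hsing ▸ hirr.forall_eval_eq_zero
      span := fun ψ hψ => exists_eq_smul_of_hasCurveDeg_two hcurve hφ0 (hsing ▸ hplane) (hsing ▸ hψ)
      exists_line := ?_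
      not_cone := ?_ }
  · intro v hv hvF
    obtain ⟨x, ⟨⟨w, hw, rfl, hq⟩, hxS⟩, hvx⟩ := hlines _ ((hS v).2 ⟨hv, hvF⟩).2
    exact ⟨_, hline w hw hq hxS, (mk_mem_lineOf_mk_iff hw hv).1 hvx⟩
  · intro v hv
    by_contra! hcon
    refine hcone ⟨Projectivization.mk K v hv, ?_⟩
    rintro _ ⟨⟨w, hw, rfl, hq⟩, hxS⟩
    exact (mk_mem_lineOf_mk_iff hw hv).2 (hcon _ (hline w hw hq hxS))

end RQS
end

section
/- Let K be a field of characteristic 0 or > 3 and let X = t₁t₃ − t₂², Y = t₂t₃ − t₁t₄, Z = t₂t₄ − t₃² in K[t₁, t₂, t₃, t₄] (the generators of the homogeneous ideal of the twisted cubic curve). Then every homogeneous polynomial F of degree 4 lying in the square (X, Y, Z)² of the ideal (X, Y, Z) can be written as F(t₁, t₂, t₃, t₄) = H(X, Y, Z) for some homogeneous polynomial H of degree 2 in three variables. -/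
/-!
STATEMENT 15: If `K` has characteristic 0 or > 3 and `X = t₁t₃ − t₂²`, `Y = t₂t₃ − t₁t₄`,
`Z = t₂t₄ − t₃²` are the generators of the homogeneous ideal of the twisted cubic, then every
homogeneous quartic `F ∈ (X,Y,Z)²` can be written as `F = H(X,Y,Z)` with `H` homogeneous of
degree 2.

Variables are indexed `0,1,2,3` for `t₁,t₂,t₃,t₄`.
-/

open MvPolynomial

/-- `X = t₁t₃ − t₂²`. -/
noncomputable def tcX (K : Type) [Field K] : MvPolynomial (Fin 4) K :=
  X 0 * X 2 - X 1 ^ 2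

/-- `Y = t₂t₃ − t₁t₄`. -/
noncomputable def tcY (K : Type) [Field K] : MvPolynomial (Fin 4) K :=
  X 1 * X 2 - X 0 * X 3

/-- `Z = t₂t₄ − t₃²`. -/
noncomputable def tcZ (K : Type) [Field K] : MvPolynomial (Fin 4) K :=
  X 1 * X 3 - X 2 ^ 2

namespace MvPolynomial

variable {σ τ R : Type*} [CommRing R]

/-- Only the constant term of `a` contributes to the degree `m` part of `a * s` when `s` is
homogeneous of degree `m`. -/
theorem homogeneousComponent_mul_of_isHomogeneous {s : MvPolynomial τ R} {m : ℕ}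
    (hs : s.IsHomogeneous m) (a : MvPolynomial τ R) :
    homogeneousComponent m (a * s) = coeff 0 a • s := by
  conv_lhs => rw [← sum_homogeneousComponent a, Finset.sum_mul, map_sum]
  rw [Finset.sum_eq_single_of_mem 0 (by simp)]
  · rw [homogeneousComponent_zero, ← smul_eq_C_mul, map_smul, homogeneousComponent_of_mem hs,
      if_pos rfl]
  · intro i _ hi
    rw [homogeneousComponent_of_mem ((homogeneousComponent_isHomogeneous i a).mul hs),
      if_neg (by omega)]

/-- A homogeneous polynomial of degree `n * d` in the `n`-th power of an ideal generated by forms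
of degree `d` is a form of degree `n` in the generators. -/
theorem exists_isHomogeneous_aeval_eq_of_mem_span_pow {g : σ → MvPolynomial τ R} {d n : ℕ}
    (hg : ∀ i, (g i).IsHomogeneous d) {F : MvPolynomial τ R} (hF : F.IsHomogeneous (n * d))
    (hmem : F ∈ Ideal.span (Set.range g) ^ n) :
    ∃ H : MvPolynomial σ R, H.IsHomogeneous n ∧ F = aeval g H := by
  suffices h : ∀ a, homogeneousComponent (n * d) (a * F) ∈
      (homogeneousSubmodule σ R n).map (aeval g).toLinearMap by
    obtain ⟨H, hH, hHF⟩ := h 1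
    rw [one_mul, homogeneousComponent_of_mem hF, if_pos rfl] at hHF
    exact ⟨H, hH, hHF.symm⟩
  clear hF
  rw [Ideal.span, Submodule.span_pow] at hmem
  induction hmem using Submodule.span_induction with
  | mem x hx =>
    intro a
    obtain ⟨f, rfl⟩ := Set.mem_pow.1 hx
    choose k hk using fun i => (f i).2
    have hx' : (List.ofFn fun i => (f i : MvPolynomial τ R)).prod =
        aeval g (∏ i, (X (k i) : MvPolynomial σ R)) := by
      simp [List.prod_ofFn, hk]
    have hs : (aeval g (∏ i, (X (k i) : MvPolynomial σ R))).IsHomogeneous (n * d) := by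
      simpa using IsHomogeneous.prod Finset.univ (fun i => g (k i)) (fun _ => d) fun i _ => hg _
    rw [hx', homogeneousComponent_mul_of_isHomogeneous hs]
    refine Submodule.smul_mem _ _ (Submodule.mem_map_of_mem ?_)
    simpa using IsHomogeneous.prod Finset.univ (fun i => (X (k i) : MvPolynomial σ R))
      (fun _ => 1) fun i _ => isHomogeneous_X R _
  | zero => simp
  | add x y _ _ hx hy =>
    intro a
    rw [mul_add, map_add]
    exact Submodule.add_mem _ (hx a) (hy a)
  | smul b x _ hx =>
    intro a
    rw [smul_eq_mul, ← mul_assoc]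
    exact hx (a * b)

end MvPolynomial

theorem statement_15 (K : Type) [Field K]
    (hchar : ringChar K = 0 ∨ 3 < ringChar K)
    (F : MvPolynomial (Fin 4) K)
    (hF4 : F.IsHomogeneous 4)
    (hFmem : F ∈ (Ideal.span {tcX K, tcY K, tcZ K}) ^ 2) :
    ∃ H : MvPolynomial (Fin 3) K, H.IsHomogeneous 2 ∧
      F = aeval ![tcX K, tcY K, tcZ K] H := by
  have hX (i j : Fin 4) : (X i * X j : MvPolynomial (Fin 4) K).IsHomogeneous 2 :=
    (isHomogeneous_X K i).mul (isHomogeneous_X K j)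
  refine exists_isHomogeneous_aeval_eq_of_mem_span_pow (d := 2) (fun i => ?_) hF4 ?_
  · fin_cases i
    · exact (hX 0 2).sub (isHomogeneous_X_pow 1 2)
    · exact (hX 1 2).sub (hX 0 3)
    · exact (hX 1 3).sub (isHomogeneous_X_pow 2 2)
  · convert hFmem using 3
    simp only [Matrix.range_cons, Matrix.range_empty, Set.union_empty, Set.singleton_union]
end
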